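/- arXiv:2605.10849 — 4 statements merged into one kernel-verified Lean document; each statement's English description precedes it below -/
import Mathlib

section
/- Let n ≥ 1, V₀ ≥ 0, f := (V₀+1)/(2V₀+1), g := 1/(2V₀+1), and let ν, w ∈ ℝⁿ with ‖ν‖ = 1, ⟨w, ν⟩ = 0 and w ≠ 0. Let M(ξ) ∈ End(ℂⁿ) be defined for ξ ≠ 0 by M(ξ)v := i·‖ξ‖⁻²·( ⟨ξ, ν⟩·v + ⟨v, ξ⟩·ν − 2f·⟨ξ, ν⟩·‖ξ‖⁻²·⟨v, ξ⟩·ξ + g·⟨v, ν⟩·ξ ). Then the End(ℂⁿ)-valued function t ↦ M(w + t·ν) + M(w − t·ν) is Bochner integrable on ℝ, and (4π)⁻¹ ∫_ℝ ( M(w + t·ν) + M(w − t·ν) ) dt = ( i·V₀ / (2·(2V₀+1)·‖w‖) ) · ( ν ⊗ w♭ − w ⊗ ν♭ ). (This is the principal symbol at the cotangent vector w of the boundary double layer operator K of the generalized Stokes operator.) -/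
open MeasureTheory Filter Topology

noncomputable section

/-- The bilinear pairing `v ↦ ⟨v, ζ⟩ = Σ_j v_j ζ_j` with `ζ ∈ ℝⁿ`, as a `ℂ`-linear functional. -/
def pairLC {n : ℕ} (ζ : Fin n → ℝ) : (Fin n → ℂ) →ₗ[ℂ] ℂ where
  toFun v := ∑ j, v j * (ζ j : ℂ)
  map_add' v w := by simp [add_mul, Finset.sum_add_distrib]
  map_smul' c v := by simp [Finset.mul_sum, mul_assoc]

/-- The rank-one endomorphism `u ⊗ ζ♭` of `ℂⁿ` given by `v ↦ ⟨v, ζ⟩·u`, for `u, ζ ∈ ℝⁿ`. -/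
def rankOneC {n : ℕ} (u ζ : Fin n → ℝ) : (Fin n → ℂ) →L[ℂ] (Fin n → ℂ) :=
  LinearMap.toContinuousLinearMap ((pairLC ζ).smulRight fun j => (u j : ℂ))

/-- The real dot product on `ℝⁿ`. -/
def rdot {n : ℕ} (ξ ν : Fin n → ℝ) : ℝ := ∑ j, ξ j * ν j

/-- The order `−1` principal symbol `M(ξ)` of the operator defining the double layer
velocity potential of the generalized Stokes operator:
`M(ξ)v = i‖ξ‖⁻²( ⟨ξ,ν⟩v + ⟨v,ξ⟩ν − 2f⟨ξ,ν⟩‖ξ‖⁻²⟨v,ξ⟩ξ + g⟨v,ν⟩ξ )`,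
where `f = (V₀+1)/(2V₀+1)` and `g = 1/(2V₀+1)`. -/
def Msymb {n : ℕ} (V₀ : ℝ) (ν ξ : Fin n → ℝ) : (Fin n → ℂ) →L[ℂ] (Fin n → ℂ) :=
  (Complex.I * (((∑ j, ξ j ^ 2)⁻¹ : ℝ) : ℂ)) •
    (((rdot ξ ν : ℝ) : ℂ) • ContinuousLinearMap.id ℂ (Fin n → ℂ) + rankOneC ν ξ -
      ((2 * ((V₀ + 1) / (2 * V₀ + 1)) * rdot ξ ν * (∑ j, ξ j ^ 2)⁻¹ : ℝ) : ℂ) • rankOneC ξ ξ +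
      (((1 / (2 * V₀ + 1)) : ℝ) : ℂ) • rankOneC ξ ν)

end

theorem integrable_inv_sq_add_sq {r : ℝ} (hr : 0 < r) :
    Integrable fun t : ℝ => (r ^ 2 + t ^ 2)⁻¹ := by
  have h := ((integrable_inv_one_add_sq).comp_div hr.ne').const_mul (r ^ 2)⁻¹
  refine h.congr (Eventually.of_forall fun t => ?_)
  have h2 : r ^ 2 + t ^ 2 ≠ 0 := by positivity
  simp only
  rw [← mul_inv]
  congr 1
  field_simp

theorem integral_univ_inv_sq_add_sq {r : ℝ} (hr : 0 < r) :
    ∫ t : ℝ, (r ^ 2 + t ^ 2)⁻¹ = Real.pi / r := by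
  have h : ∀ t : ℝ, (r ^ 2 + t ^ 2)⁻¹ = (r ^ 2)⁻¹ * (1 + (t / r) ^ 2)⁻¹ := by
    intro t
    rw [← mul_inv]
    congr 1
    field_simp
  simp_rw [h]
  rw [integral_const_mul, Measure.integral_comp_div (fun x : ℝ => (1 + x ^ 2)⁻¹),
    integral_univ_inv_one_add_sq, abs_of_pos hr, smul_eq_mul]
  field_simp

theorem integrable_sq_mul_inv_sq_add_sq_sq {r : ℝ} (hr : 0 < r) :
    Integrable fun t : ℝ => t ^ 2 * ((r ^ 2 + t ^ 2)⁻¹) ^ 2 := by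
  refine (integrable_inv_sq_add_sq hr).mono' (by fun_prop) (Eventually.of_forall fun t => ?_)
  have h2 : 0 < r ^ 2 + t ^ 2 := by positivity
  rw [Real.norm_of_nonneg (by positivity)]
  have h3 : t ^ 2 * (r ^ 2 + t ^ 2)⁻¹ ≤ 1 := by
    rw [← div_eq_mul_inv, div_le_one h2]
    nlinarith [sq_nonneg r]
  calc t ^ 2 * ((r ^ 2 + t ^ 2)⁻¹) ^ 2 = (t ^ 2 * (r ^ 2 + t ^ 2)⁻¹) * (r ^ 2 + t ^ 2)⁻¹ := by ring
    _ ≤ 1 * (r ^ 2 + t ^ 2)⁻¹ := by gcongr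
    _ = _ := one_mul _

theorem tendsto_mul_inv_sq_add_sq_cobounded (r : ℝ) :
    Tendsto (fun t : ℝ => t * (r ^ 2 + t ^ 2)⁻¹) (Bornology.cobounded ℝ) (𝓝 0) := by
  refine squeeze_zero_norm (fun t => ?_)
    (tendsto_norm_zero.comp (tendsto_inv₀_cobounded (α := ℝ)))
  rcases eq_or_ne t 0 with rfl | ht
  · simp
  have h2 : 0 < r ^ 2 + t ^ 2 := by positivity
  simp only [Function.comp, norm_mul, norm_inv, Real.norm_eq_abs]
  have h3 : 0 < |t| := abs_pos.mpr ht
  rw [abs_of_pos h2, ← div_eq_mul_inv, div_le_iff₀ h2, ← div_eq_inv_mul, le_div_iff₀ h3,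
    abs_mul_abs_self]
  nlinarith [sq_nonneg r]

theorem integral_sq_mul_inv_sq_add_sq_sq {r : ℝ} (hr : 0 < r) :
    ∫ t : ℝ, t ^ 2 * ((r ^ 2 + t ^ 2)⁻¹) ^ 2 = Real.pi / (2 * r) := by
  have hi1 := integrable_inv_sq_add_sq hr
  have hi2 := (integrable_sq_mul_inv_sq_add_sq_sq hr).const_mul 2
  have hd : ∀ t : ℝ, HasDerivAt (fun t : ℝ => t * (r ^ 2 + t ^ 2)⁻¹)
      ((r ^ 2 + t ^ 2)⁻¹ - 2 * (t ^ 2 * ((r ^ 2 + t ^ 2)⁻¹) ^ 2)) t := by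
    intro t
    have h2 : r ^ 2 + t ^ 2 ≠ 0 := by positivity
    have h := (hasDerivAt_id t).mul ((((hasDerivAt_id t).pow 2).const_add (r ^ 2)).inv h2)
    refine h.congr_deriv ?_
    simp only [id, Pi.pow_apply, Pi.inv_apply]
    field_simp
    ring
  have hc := tendsto_mul_inv_sq_add_sq_cobounded r
  have h := integral_of_hasDerivAt_of_tendsto hd (hi1.sub hi2)
    (hc.mono_left IsOrderBornology.atBot_le_cobounded) (hc.mono_left IsOrderBornology.atTop_le_cobounded)
  rw [integral_sub hi1 hi2, integral_const_mul, integral_univ_inv_sq_add_sq hr] at h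
  rw [mul_comm 2 r, ← div_div]
  linarith

section rankOneC

variable {n : ℕ}

theorem rankOneC_apply (u ζ : Fin n → ℝ) (v : Fin n → ℂ) (k : Fin n) :
    rankOneC u ζ v k = (∑ j, v j * (ζ j : ℂ)) * (u k : ℂ) := rfl

theorem rankOneC_add_left (u u' ζ : Fin n → ℝ) :
    rankOneC (u + u') ζ = rankOneC u ζ + rankOneC u' ζ := by
  refine ContinuousLinearMap.ext fun v => funext fun k => ?_
  simp [rankOneC_apply, mul_add]

theorem rankOneC_smul_left (c : ℝ) (u ζ : Fin n → ℝ) :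
    rankOneC (c • u) ζ = (c : ℂ) • rankOneC u ζ := by
  refine ContinuousLinearMap.ext fun v => funext fun k => ?_
  simp [rankOneC_apply, mul_left_comm]

theorem rankOneC_add_right (u ζ ζ' : Fin n → ℝ) :
    rankOneC u (ζ + ζ') = rankOneC u ζ + rankOneC u ζ' := by
  refine ContinuousLinearMap.ext fun v => funext fun k => ?_
  simp [rankOneC_apply, mul_add, add_mul, Finset.sum_add_distrib]

theorem rankOneC_smul_right (c : ℝ) (u ζ : Fin n → ℝ) :
    rankOneC u (c • ζ) = (c : ℂ) • rankOneC u ζ := by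
  refine ContinuousLinearMap.ext fun v => funext fun k => ?_
  have h (j : Fin n) : v j * ((c : ℂ) * (ζ j : ℂ)) = c * (v j * (ζ j : ℂ)) := mul_left_comm _ _ _
  simp [rankOneC_apply, h, ← Finset.mul_sum, mul_assoc]

theorem real_smul_eq_coe_smul_continuousLinearMap (c : ℝ) (A : (Fin n → ℂ) →L[ℂ] (Fin n → ℂ)) :
    c • A = (c : ℂ) • A := by
  refine ContinuousLinearMap.ext fun v => funext fun k => ?_
  simp

theorem rdot_add_smul_self {ν w : Fin n → ℝ} (hν : ∑ j, ν j ^ 2 = 1) (hw : rdot w ν = 0)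
    (t : ℝ) : rdot (w + t • ν) ν = t := by
  have h : rdot (w + t • ν) ν = rdot w ν + t * ∑ j, ν j ^ 2 := by
    simp only [rdot, Finset.mul_sum, ← Finset.sum_add_distrib]
    refine Finset.sum_congr rfl fun j _ => ?_
    simp only [Pi.add_apply, Pi.smul_apply, smul_eq_mul]
    ring
  rw [h, hw, hν]
  ring

theorem sum_sq_add_smul {ν w : Fin n → ℝ} (hν : ∑ j, ν j ^ 2 = 1) (hw : rdot w ν = 0)
    (t : ℝ) : ∑ j, (w + t • ν) j ^ 2 = ∑ j, w j ^ 2 + t ^ 2 := by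
  have h : ∑ j, (w + t • ν) j ^ 2 =
      ∑ j, w j ^ 2 + 2 * t * rdot w ν + t ^ 2 * ∑ j, ν j ^ 2 := by
    simp only [rdot, Finset.mul_sum, ← Finset.sum_add_distrib]
    refine Finset.sum_congr rfl fun j _ => ?_
    simp only [Pi.add_apply, Pi.smul_apply, smul_eq_mul]
    ring
  rw [h, hw, hν]
  ring

theorem Msymb_add_smul_add_Msymb_sub_smul (V₀ : ℝ) {ν w : Fin n → ℝ}
    (hν : ∑ j, ν j ^ 2 = 1) (hw : rdot w ν = 0) (t : ℝ) :
    Msymb V₀ ν (w + t • ν) + Msymb V₀ ν (w - t • ν) =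
      (∑ j, w j ^ 2 + t ^ 2)⁻¹ • ((2 * Complex.I) •
        (rankOneC ν w + ((1 / (2 * V₀ + 1) : ℝ) : ℂ) • rankOneC w ν)) -
      (t ^ 2 * ((∑ j, w j ^ 2 + t ^ 2)⁻¹) ^ 2) •
        ((4 * Complex.I * (((V₀ + 1) / (2 * V₀ + 1) : ℝ) : ℂ)) •
          (rankOneC ν w + rankOneC w ν)) := by
  have hs : w - t • ν = w + (-t) • ν := by rw [neg_smul, sub_eq_add_neg]
  rw [hs]
  simp only [Msymb, rdot_add_smul_self hν hw, sum_sq_add_smul hν hw, neg_sq,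
    rankOneC_add_left, rankOneC_add_right, rankOneC_smul_left, rankOneC_smul_right]
  generalize (∑ j, w j ^ 2 + t ^ 2)⁻¹ = R
  generalize (V₀ + 1) / (2 * V₀ + 1) = f
  generalize 1 / (2 * V₀ + 1) = g
  simp only [real_smul_eq_coe_smul_continuousLinearMap]
  push_cast
  module

end rankOneC

/-- For a unit normal `ν` and `0 ≠ w ⊥ ν`, the function
`t ↦ M(w + t·ν) + M(w − t·ν)` is Bochner integrable on `ℝ` with values in `End(ℂⁿ)`, and
`(4π)⁻¹ ∫ (M(w+tν) + M(w−tν)) dt = (iV₀/(2(2V₀+1)‖w‖))·(ν ⊗ w♭ − w ⊗ ν♭)`.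
(This is the principal symbol at `w` of the boundary double layer operator `K` of the
generalized Stokes operator.) -/
theorem boundary_double_layer_principal_symbol (n : ℕ) (hn : 1 ≤ n)
    (V₀ : ℝ) (hV₀ : 0 ≤ V₀) (ν w : Fin n → ℝ)
    (hν : ∑ j, ν j ^ 2 = 1) (hw : rdot w ν = 0) (hw0 : w ≠ 0) :
    (Integrable fun t : ℝ => Msymb V₀ ν (w + t • ν) + Msymb V₀ ν (w - t • ν)) ∧
    ((4 * Real.pi : ℝ) : ℂ)⁻¹ •
        (∫ t : ℝ, (Msymb V₀ ν (w + t • ν) + Msymb V₀ ν (w - t • ν))) =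
      (Complex.I * (V₀ : ℂ) /
          ((2 * (2 * V₀ + 1) * Real.sqrt (∑ j, w j ^ 2) : ℝ) : ℂ)) •
        (rankOneC ν w - rankOneC w ν) := by
  have hr2 : 0 < ∑ j, w j ^ 2 := by
    obtain ⟨k, hk⟩ := Function.ne_iff.mp hw0
    exact Finset.sum_pos' (fun j _ => sq_nonneg _)
      ⟨k, Finset.mem_univ k, pow_pos (abs_pos.mpr hk) 2 |>.trans_eq (sq_abs _)⟩
  obtain ⟨r, hr, hrw⟩ : ∃ r : ℝ, 0 < r ∧ ∑ j, w j ^ 2 = r ^ 2 :=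
    ⟨_, Real.sqrt_pos.mpr hr2, (Real.sq_sqrt hr2.le).symm⟩
  simp_rw [Msymb_add_smul_add_Msymb_sub_smul V₀ hν hw, hrw, Real.sqrt_sq hr.le]
  have hi1 := fun A : (Fin n → ℂ) →L[ℂ] (Fin n → ℂ) =>
    (integrable_inv_sq_add_sq hr).smul_const A
  have hi2 := fun A : (Fin n → ℂ) →L[ℂ] (Fin n → ℂ) =>
    (integrable_sq_mul_inv_sq_add_sq_sq hr).smul_const A
  refine ⟨(hi1 _).sub (hi2 _), ?_⟩
  rw [integral_sub (hi1 _) (hi2 _), integral_smul_const, integral_smul_const,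
    integral_univ_inv_sq_add_sq hr, integral_sq_mul_inv_sq_add_sq_sq hr]
  have hrc : (r : ℂ) ≠ 0 := by exact_mod_cast hr.ne'
  have hpi : (Real.pi : ℂ) ≠ 0 := by exact_mod_cast Real.pi_ne_zero
  have hV : (2 * (V₀ : ℂ) + 1) ≠ 0 := by
    have : 2 * V₀ + 1 ≠ 0 := by positivity
    exact_mod_cast this
  simp only [real_smul_eq_coe_smul_continuousLinearMap]
  push_cast
  match_scalars
  all_goals
    field_simp
    ring
end

section
/- Let n ≥ 2, let c_n := Γ(n/2)/π^{n/2}, and let h : ℝ^{n−1} → ℂ be bounded and continuous. For x' ∈ ℝ^{n−1} and t ≠ 0 define u(x', t) := (c_n/2) · t · ∫_{ℝ^{n−1}} h(y') · ( ‖x' − y'‖² + t² )^{−n/2} dy'. Then the integral converges absolutely for every (x', t) with t ≠ 0, and for every x' ∈ ℝ^{n−1}: u(x', t) → h(x')/2 as t → 0⁺, and u(x', t) → −h(x')/2 as t → 0⁻. (These are the one-sided boundary limits, with jump h, of the double layer potential of the Laplace operator on the half-space {x_n > 0}.) -/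
open MeasureTheory Filter Topology

noncomputable section

/-- The normalization constant `c_n = Γ(n/2)/π^{n/2}` (with `n = d+1`) of the double layer
kernel of the Laplacian on a half-space. -/
def laplaceDLConst (d : ℕ) : ℝ :=
  Real.Gamma (((d : ℝ) + 1) / 2) / Real.pi ^ (((d : ℝ) + 1) / 2)

/-- The double layer potential `u(x',t) = (c_n/2)·t·∫ h(y')(‖x'−y'‖²+t²)^{−n/2} dy'` of the
Laplace operator on the half-space, applied to a boundary density `h`. -/
def laplaceDL (d : ℕ) (h : (Fin d → ℝ) → ℂ) (x' : Fin d → ℝ) (t : ℝ) : ℂ :=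
  ((laplaceDLConst d / 2 * t : ℝ) : ℂ) *
    ∫ y : Fin d → ℝ,
      h y * ((((∑ i, (x' i - y i) ^ 2) + t ^ 2) ^ (-((d : ℝ) + 1) / 2) : ℝ) : ℂ)

end

theorem integrable_one_add_sum_sq_rpow (d : ℕ) :
    Integrable fun y : Fin d → ℝ => (1 + ∑ i, y i ^ 2) ^ (-((d : ℝ) + 1) / 2) := by
  have hint : Integrable fun y : Fin d → ℝ => (1 + ‖y‖ ^ 2) ^ (-((d : ℝ) + 1) / 2) :=
    integrable_rpow_neg_one_add_norm_sq (by simp)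
  have hsum (y : Fin d → ℝ) : 0 ≤ ∑ i, y i ^ 2 := Finset.sum_nonneg fun i _ => sq_nonneg _
  refine hint.mono' (Measurable.aestronglyMeasurable (by fun_prop))
    (Eventually.of_forall fun y => ?_)
  have hle : ‖y‖ ^ 2 ≤ ∑ i, y i ^ 2 := by
    have hy : ‖y‖ ≤ √(∑ i, y i ^ 2) := by
      refine (pi_norm_le_iff_of_nonneg (Real.sqrt_nonneg _)).2 fun i => ?_
      refine Real.le_sqrt_of_sq_le ?_
      rw [Real.norm_eq_abs, sq_abs]
      exact Finset.single_le_sum (f := fun i => y i ^ 2) (fun i _ => sq_nonneg _)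
        (Finset.mem_univ i)
    calc ‖y‖ ^ 2 ≤ √(∑ i, y i ^ 2) ^ 2 := by gcongr
      _ = _ := Real.sq_sqrt (hsum y)
  rw [Real.norm_of_nonneg (Real.rpow_nonneg (by linarith [hsum y]) _)]
  refine Real.rpow_le_rpow_of_nonpos (by positivity) (by linarith) ?_
  have : (0 : ℝ) ≤ d := d.cast_nonneg
  linarith

theorem integral_exp_neg_mul_sum_sq (d : ℕ) {s : ℝ} (hs : 0 < s) :
    ∫ y : Fin d → ℝ, Real.exp (-(s * ∑ i, y i ^ 2)) = (Real.pi / s) ^ ((d : ℝ) / 2) := by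
  have h1 (y : Fin d → ℝ) :
      Real.exp (-(s * ∑ i, y i ^ 2)) = ∏ i, Real.exp (-s * y i ^ 2) := by
    rw [← Real.exp_sum, Finset.mul_sum, ← Finset.sum_neg_distrib]
    simp
  simp_rw [h1]
  rw [integral_fintype_prod_volume_eq_pow (fun x : ℝ => Real.exp (-s * x ^ 2)),
    integral_gaussian, Fintype.card_fin, Real.sqrt_eq_rpow, ← Real.rpow_natCast,
    ← Real.rpow_mul (by positivity)]
  congr 1
  ring

theorem Gamma_mul_integral_one_add_sum_sq_rpow (d : ℕ) :
    Real.Gamma (((d : ℝ) + 1) / 2) *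
      ∫ y : Fin d → ℝ, (1 + ∑ i, y i ^ 2) ^ (-((d : ℝ) + 1) / 2) =
      Real.pi ^ (((d : ℝ) + 1) / 2) := by
  have ha : 0 < ((d : ℝ) + 1) / 2 := by positivity
  have hpos (y : Fin d → ℝ) : 0 < 1 + ∑ i, y i ^ 2 := by
    have : 0 ≤ ∑ i, y i ^ 2 := Finset.sum_nonneg fun i _ => sq_nonneg _
    linarith
  set G : (Fin d → ℝ) → ℝ → ℝ := fun y s =>
    s ^ (((d : ℝ) + 1) / 2 - 1) * Real.exp (-((1 + ∑ i, y i ^ 2) * s)) with hG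
  have hGnonneg (y : Fin d → ℝ) {s : ℝ} (hs : 0 < s) : 0 ≤ G y s := by positivity
  have hinner (y : Fin d → ℝ) : ∫ s in Set.Ioi 0, G y s =
      Real.Gamma (((d : ℝ) + 1) / 2) * (1 + ∑ i, y i ^ 2) ^ (-((d : ℝ) + 1) / 2) := by
    rw [Real.integral_rpow_mul_exp_neg_mul_Ioi ha (hpos y), one_div,
      Real.inv_rpow (hpos y).le, ← Real.rpow_neg (hpos y).le, mul_comm]
    congr 2
    ring
  have hGint (y : Fin d → ℝ) : Integrable (G y) (volume.restrict (Set.Ioi 0)) := by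
    refine Integrable.of_integral_ne_zero ?_
    rw [hinner]
    exact (mul_pos (Real.Gamma_pos_of_pos ha) (Real.rpow_pos_of_pos (hpos y) _)).ne'
  have hmeas : AEStronglyMeasurable (Function.uncurry G)
      ((volume : Measure (Fin d → ℝ)).prod (volume.restrict (Set.Ioi 0))) := by
    refine Measurable.aestronglyMeasurable ?_
    simp only [hG, Function.uncurry_def]
    fun_prop
  have hprod : Integrable (Function.uncurry G)
      ((volume : Measure (Fin d → ℝ)).prod (volume.restrict (Set.Ioi 0))) := by
    refine (integrable_prod_iff hmeas).2 ⟨Eventually.of_forall hGint, ?_⟩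
    refine ((integrable_one_add_sum_sq_rpow d).const_mul
      (Real.Gamma (((d : ℝ) + 1) / 2))).congr (Eventually.of_forall fun y => ?_)
    dsimp only
    rw [← hinner y]
    exact setIntegral_congr_fun measurableSet_Ioi fun s hs =>
      (Real.norm_of_nonneg (hGnonneg y hs)).symm
  have houter {s : ℝ} (hs : 0 < s) : ∫ y, G y s =
      Real.pi ^ ((d : ℝ) / 2) * (s ^ ((1 : ℝ) / 2 - 1) * Real.exp (-(1 * s))) := by
    have h1 (y : Fin d → ℝ) : G y s =
        s ^ (((d : ℝ) + 1) / 2 - 1) * Real.exp (-s) * Real.exp (-(s * ∑ i, y i ^ 2)) := by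
      rw [mul_assoc, ← Real.exp_add]
      simp only [hG]
      congr 2
      ring
    simp_rw [h1]
    rw [integral_const_mul, integral_exp_neg_mul_sum_sq d hs,
      Real.div_rpow Real.pi_pos.le hs.le, one_mul,
      show ((d : ℝ) + 1) / 2 - 1 = (1 / 2 - 1) + (d : ℝ) / 2 by ring, Real.rpow_add hs]
    have : s ^ ((d : ℝ) / 2) ≠ 0 := (Real.rpow_pos_of_pos hs _).ne'
    field_simp
  rw [← integral_const_mul]
  simp_rw [← hinner]
  rw [integral_integral_swap hprod,
    setIntegral_congr_fun measurableSet_Ioi fun s hs => houter hs, integral_const_mul,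
    Real.integral_rpow_mul_exp_neg_mul_Ioi (by norm_num) one_pos, Real.Gamma_one_half_eq,
    Real.sqrt_eq_rpow, add_div, Real.rpow_add Real.pi_pos]
  simp

theorem integral_laplaceDLConst_mul (d : ℕ) :
    ∫ y : Fin d → ℝ, laplaceDLConst d * (1 + ∑ i, y i ^ 2) ^ (-((d : ℝ) + 1) / 2) = 1 := by
  rw [integral_const_mul, laplaceDLConst, div_mul_eq_mul_div,
    Gamma_mul_integral_one_add_sum_sq_rpow]
  exact div_self (Real.rpow_pos_of_pos Real.pi_pos _).ne'

theorem sum_smul_sq_add_sq_rpow {d : ℕ} (z : Fin d → ℝ) (t r : ℝ) :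
    ((∑ i, (t * z i) ^ 2) + t ^ 2) ^ r = (t ^ 2) ^ r * (1 + ∑ i, z i ^ 2) ^ r := by
  have : 0 ≤ ∑ i, z i ^ 2 := Finset.sum_nonneg fun i _ => sq_nonneg _
  rw [← Real.mul_rpow (sq_nonneg t) (by linarith), mul_add, Finset.mul_sum, mul_one, add_comm]
  simp_rw [mul_pow]

theorem integrable_laplaceDL_kernel {d : ℕ} (x : Fin d → ℝ) {t : ℝ} (ht : t ≠ 0) :
    Integrable fun y : Fin d → ℝ =>
      ((∑ i, (x i - y i) ^ 2) + t ^ 2) ^ (-((d : ℝ) + 1) / 2) := by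
  refine ((((integrable_one_add_sum_sq_rpow d).comp_smul (inv_ne_zero ht)).comp_sub_left
    x).const_mul ((t ^ 2) ^ (-((d : ℝ) + 1) / 2))).congr (Eventually.of_forall fun y => ?_)
  dsimp only
  rw [← sum_smul_sq_add_sq_rpow]
  simp [mul_inv_cancel_left₀ ht]

theorem laplaceDL_neg (d : ℕ) (h : (Fin d → ℝ) → ℂ) (x : Fin d → ℝ) (t : ℝ) :
    laplaceDL d h x (-t) = -laplaceDL d h x t := by
  simp [laplaceDL]

theorem laplaceDL_eq_integral_comp_smul {d : ℕ} (h : (Fin d → ℝ) → ℂ) (x : Fin d → ℝ) {t : ℝ}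
    (ht : 0 < t) :
    laplaceDL d h x t = ∫ z : Fin d → ℝ, h (x + t • z) *
      ((laplaceDLConst d * (1 + ∑ i, z i ^ 2) ^ (-((d : ℝ) + 1) / 2) / 2 : ℝ) : ℂ) := by
  set F : (Fin d → ℝ) → ℂ := fun y =>
    h y * ((((∑ i, (x i - y i) ^ 2) + t ^ 2) ^ (-((d : ℝ) + 1) / 2) : ℝ) : ℂ) with hF
  have hscale : ∫ y, F y = ((t ^ d : ℝ) : ℂ) * ∫ z, F (x + t • z) := by
    rw [Measure.integral_comp_smul volume (fun y => F (x + y)) t,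
      integral_add_left_eq_self F x, abs_of_pos (by positivity), Module.finrank_fin_fun,
      Complex.real_smul, ← mul_assoc, ← Complex.ofReal_mul, mul_inv_cancel₀ (by positivity)]
    simp
  have hpow : t * t ^ d * (t ^ 2) ^ (-((d : ℝ) + 1) / 2) = 1 := by
    rw [← Real.rpow_natCast t 2, ← Real.rpow_mul ht.le, ← pow_succ', ← Real.rpow_natCast,
      ← Real.rpow_add ht]
    have : ((d + 1 : ℕ) : ℝ) + ((2 : ℕ) : ℝ) * (-((d : ℝ) + 1) / 2) = 0 := by
      push_cast
      ring
    rw [this, Real.rpow_zero]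
  change _ * ∫ y, F y = _
  rw [hscale, ← mul_assoc, ← integral_const_mul]
  congr 1 with z
  have hker : (∑ i, (x i - (x + t • z) i) ^ 2) = ∑ i, (t * z i) ^ 2 := by simp
  simp only [hF]
  rw [hker, sum_smul_sq_add_sq_rpow, mul_left_comm, ← Complex.ofReal_mul, ← Complex.ofReal_mul]
  congr 2
  linear_combination
    laplaceDLConst d * (1 + ∑ i, z i ^ 2) ^ (-((d : ℝ) + 1) / 2) / 2 * hpow

theorem tendsto_laplaceDL_nhdsGT {d : ℕ} {h : (Fin d → ℝ) → ℂ} (hcont : Continuous h) {B : ℝ}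
    (hB : ∀ y, ‖h y‖ ≤ B) (x : Fin d → ℝ) :
    Tendsto (fun t : ℝ => laplaceDL d h x t) (𝓝[>] 0) (𝓝 (h x / 2)) := by
  set p : (Fin d → ℝ) → ℝ := fun z =>
    laplaceDLConst d * (1 + ∑ i, z i ^ 2) ^ (-((d : ℝ) + 1) / 2) / 2 with hp
  have hpint : Integrable p :=
    ((integrable_one_add_sum_sq_rpow d).const_mul _).div_const 2
  have hlim : ∫ z, h x * ((p z : ℝ) : ℂ) = h x / 2 := by
    rw [integral_const_mul, integral_complex_ofReal, integral_div, integral_laplaceDLConst_mul]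
    push_cast
    ring
  have heq : (fun t : ℝ => ∫ z, h (x + t • z) * ((p z : ℝ) : ℂ)) =ᶠ[𝓝[>] 0]
      fun t => laplaceDL d h x t := by
    filter_upwards [self_mem_nhdsWithin] with t ht
    exact (laplaceDL_eq_integral_comp_smul h x ht).symm
  refine Tendsto.congr' heq ?_
  rw [← hlim]
  refine tendsto_integral_filter_of_dominated_convergence (fun z => B * ‖p z‖) ?_ ?_
    (hpint.norm.const_mul B) ?_
  · refine Eventually.of_forall fun t => ?_
    exact (hcont.comp (by fun_prop)).aestronglyMeasurable.mul
      hpint.ofReal.aestronglyMeasurable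
  · refine Eventually.of_forall fun t => Eventually.of_forall fun z => ?_
    rw [norm_mul, Complex.norm_real]
    exact mul_le_mul_of_nonneg_right (hB _) (norm_nonneg _)
  · refine Eventually.of_forall fun z => ?_
    have hc : Continuous fun t : ℝ => h (x + t • z) * ((p z : ℝ) : ℂ) :=
      (hcont.comp (by fun_prop)).mul continuous_const
    simpa using (hc.tendsto 0).mono_left nhdsWithin_le_nhds

/-- For `n = d+1 ≥ 2` and a bounded continuous density `h` on `ℝ^{n−1}`, the double layer
potential `u(x',t)` of the Laplacian on the half-space `{x_n > 0}` is defined by an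
absolutely convergent integral for every `t ≠ 0`, and has the one-sided boundary
limits `u(x',t) → ±h(x')/2` as `t → 0±`; in particular its jump across the boundary is `h`. -/
theorem laplace_double_layer_jump (d : ℕ) (hd : 1 ≤ d)
    (h : (Fin d → ℝ) → ℂ) (hcont : Continuous h) (B : ℝ) (hB : ∀ y, ‖h y‖ ≤ B) :
    (∀ (x' : Fin d → ℝ) (t : ℝ), t ≠ 0 →
      Integrable fun y : Fin d → ℝ =>
        h y * ((((∑ i, (x' i - y i) ^ 2) + t ^ 2) ^ (-((d : ℝ) + 1) / 2) : ℝ) : ℂ)) ∧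
    ∀ x' : Fin d → ℝ,
      Tendsto (fun t : ℝ => laplaceDL d h x' t) (𝓝[>] 0) (𝓝 (h x' / 2)) ∧
      Tendsto (fun t : ℝ => laplaceDL d h x' t) (𝓝[<] 0) (𝓝 (-(h x' / 2))) := by
  refine ⟨fun x t ht => ?_, fun x => ⟨tendsto_laplaceDL_nhdsGT hcont hB x, ?_⟩⟩
  · exact (integrable_laplaceDL_kernel x ht).ofReal.bdd_mul hcont.aestronglyMeasurable
      (Eventually.of_forall hB)
  · have hneg : Tendsto (fun t : ℝ => -t) (𝓝[<] 0) (𝓝[>] 0) := by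
      simpa using tendsto_neg_nhdsLT (a := (0 : ℝ))
    simpa [Function.comp_def, laplaceDL_neg] using
      ((tendsto_laplaceDL_nhdsGT hcont hB x).comp hneg).neg
end

section
/- Let n ≥ 2, let m < −1, let a : ℝⁿ × ℝⁿ → ℂ be continuous with |a(x, ξ)| ≤ C ⟨ξ⟩^m for all (x, ξ) and some C ≥ 0, and let h : ℝ^{n−1} → ℂ be a Schwartz function with Fourier transform ĥ(η) := ∫_{ℝ^{n−1}} e^{−i y·η} h(y) dy. Define u(x) := (2π)^{−n} ∫_{ℝⁿ} e^{i x·ξ} a(x, ξ) ĥ(ξ') dξ, where ξ' ∈ ℝ^{n−1} denotes the first n−1 coordinates of ξ. Then: (a) the integral converges absolutely for every x ∈ ℝⁿ; (b) u is continuous on all of ℝⁿ — in particular the layer potential has no jump across the hyperplane {x_n = 0}, its lateral limits from the two half-spaces {±x_n > 0} coinciding with its restriction; (c) for every x' ∈ ℝ^{n−1}: u(x', 0) = (2π)^{−(n−1)} ∫_{ℝ^{n−1}} e^{i x'·η} b(x', η) ĥ(η) dη, where b(x', η) := (2π)⁻¹ ∫_ℝ a((x', 0), (η, τ)) dτ.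 -/
open MeasureTheory

noncomputable section

/-- The Fourier transform `ĥ(η) = ∫ e^{−i y·η} h(y) dy` on `ℝ^d`. -/
def fTrans (d : ℕ) (h : (Fin d → ℝ) → ℂ) (η : Fin d → ℝ) : ℂ :=
  ∫ y : Fin d → ℝ, Complex.exp (-(Complex.I * ((∑ i, y i * η i : ℝ) : ℂ))) * h y

end

open scoped FourierTransform

lemma fTrans_eq_schwartzMap (d : ℕ) (h : SchwartzMap (Fin d → ℝ) ℂ) :
    ∃ g : SchwartzMap (Fin d → ℝ) ℂ, ∀ η, fTrans d (fun y => h y) η = g η := by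
  let e : EuclideanSpace ℝ (Fin d) ≃L[ℝ] (Fin d → ℝ) := EuclideanSpace.equiv (Fin d) ℝ
  let c : (Fin d → ℝ) ≃L[ℝ] (Fin d → ℝ) :=
    ContinuousLinearEquiv.smulLeft (Units.mk0 (2 * Real.pi)⁻¹ (by positivity))
  let H : SchwartzMap (EuclideanSpace ℝ (Fin d)) ℂ :=
    SchwartzMap.compCLMOfContinuousLinearEquiv ℂ e h
  refine ⟨SchwartzMap.compCLMOfContinuousLinearEquiv ℂ (c.trans e.symm) (𝓕 H), fun η => ?_⟩
  have hc : (c.trans e.symm) η = WithLp.toLp 2 ((2 * Real.pi)⁻¹ • η) := rfl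
  rw [SchwartzMap.compCLMOfContinuousLinearEquiv_apply, Function.comp_apply, hc,
    SchwartzMap.fourier_coe, Real.fourier_eq',
    ← (PiLp.volume_preserving_toLp (Fin d)).integral_comp
      (MeasurableEquiv.toLp 2 (Fin d → ℝ)).measurableEmbedding]
  refine integral_congr_ae (.of_forall fun y => ?_)
  have hH : H (WithLp.toLp 2 y) = h y := rfl
  have hin : -2 * Real.pi * inner ℝ (WithLp.toLp 2 y : EuclideanSpace ℝ (Fin d))
      (WithLp.toLp 2 ((2 * Real.pi)⁻¹ • η)) = -∑ i, y i * η i := by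
    simp only [PiLp.inner_apply, Pi.smul_apply, smul_eq_mul, RCLike.inner_apply, conj_trivial,
      Finset.mul_sum, ← Finset.sum_neg_distrib]
    refine Finset.sum_congr rfl fun i _ => ?_
    field_simp
  simp only [hin, hH, smul_eq_mul, Complex.ofReal_neg]
  ring_nf

/-- The measurable equivalence `ℝ^d × ℝ ≃ ℝ^{d+1}` appending the last coordinate. -/
def snocMeasurableEquiv (d : ℕ) : (Fin d → ℝ) × ℝ ≃ᵐ (Fin (d + 1) → ℝ) :=
  MeasurableEquiv.prodComm.trans
    (MeasurableEquiv.piFinSuccAbove (fun _ : Fin (d + 1) => ℝ) (Fin.last d)).symm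

lemma snocMeasurableEquiv_apply (d : ℕ) (p : (Fin d → ℝ) × ℝ) :
    snocMeasurableEquiv d p = (Fin.snoc p.1 p.2 : Fin (d + 1) → ℝ) :=
  Fin.insertNth_last' p.2 p.1

lemma measurePreserving_snocMeasurableEquiv (d : ℕ) :
    MeasurePreserving (snocMeasurableEquiv d) :=
  Measure.measurePreserving_swap.trans
    (volume_preserving_piFinSuccAbove (fun _ : Fin (d + 1) => ℝ) (Fin.last d)).symm

lemma integrable_rpow_last_mul_init {d : ℕ} {m : ℝ} (hm : m < -1) {g : (Fin d → ℝ) → ℝ}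
    (hg : Integrable g) :
    Integrable fun ξ : Fin (d + 1) → ℝ =>
      (1 + ξ (Fin.last d) ^ 2) ^ (m / 2) * g (Fin.init ξ) := by
  have h1 : Integrable fun τ : ℝ => (1 + τ ^ 2) ^ (m / 2) := by
    have := integrable_rpow_neg_one_add_norm_sq (E := ℝ) (μ := volume) (r := -m)
      (by simp; linarith)
    simpa using this
  rw [← (measurePreserving_snocMeasurableEquiv d).integrable_comp_emb
    (snocMeasurableEquiv d).measurableEmbedding]
  refine (hg.mul_prod h1).congr (.of_forall fun p => ?_)
  simp [snocMeasurableEquiv_apply, mul_comm]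

lemma integral_eq_integral_integral_snoc {d : ℕ} {f : (Fin (d + 1) → ℝ) → ℂ}
    (hf : Integrable f) :
    ∫ ξ, f ξ = ∫ η : Fin d → ℝ, ∫ τ : ℝ, f (Fin.snoc η τ) := by
  have hmp := measurePreserving_snocMeasurableEquiv d
  have hemb := (snocMeasurableEquiv d).measurableEmbedding
  have hf' := (hmp.integrable_comp_emb hemb).2 hf
  rw [← hmp.integral_comp hemb]
  refine (integral_prod _ hf').trans ?_
  simp only [Function.comp_apply, snocMeasurableEquiv_apply]

lemma continuous_fin_init (d : ℕ) :
    Continuous fun ξ : Fin (d + 1) → ℝ => (Fin.init ξ : Fin d → ℝ) :=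
  continuous_pi fun i => continuous_apply i.castSucc

lemma norm_layerIntegrand_le {d : ℕ} {m : ℝ} (hm : m < -1) {C : ℝ} (hC : 0 ≤ C)
    {a : (Fin (d + 1) → ℝ) → (Fin (d + 1) → ℝ) → ℂ}
    (ha_bd : ∀ (x ξ : Fin (d + 1) → ℝ),
      ‖a x ξ‖ ≤ C * (1 + (∑ i, ξ i ^ 2)) ^ (m / 2))
    (g : (Fin d → ℝ) → ℂ) (x ξ : Fin (d + 1) → ℝ) :
    ‖Complex.exp (Complex.I * ((∑ i, x i * ξ i : ℝ) : ℂ)) * a x ξ * g (Fin.init ξ)‖ ≤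
      C * ((1 + ξ (Fin.last d) ^ 2) ^ (m / 2) * ‖g (Fin.init ξ)‖) := by
  rw [norm_mul, norm_mul, mul_comm Complex.I, Complex.norm_exp_ofReal_mul_I, one_mul, ← mul_assoc]
  gcongr
  refine (ha_bd x ξ).trans ?_
  gcongr C * ?_
  refine Real.rpow_le_rpow_of_nonpos (by positivity) ?_ (by linarith)
  gcongr
  exact Finset.single_le_sum (f := fun i => ξ i ^ 2) (fun i _ => sq_nonneg _) (Finset.mem_univ _)

/-- Let `n = d+1 ≥ 2`, `m < −1`, `a : ℝⁿ × ℝⁿ → ℂ` continuous with `|a(x,ξ)| ≤ C⟨ξ⟩^m`, and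
let `h` be Schwartz on `ℝ^{n−1}`.  Then the layer potential
`u(x) = (2π)^{−n} ∫ e^{ix·ξ} a(x,ξ) ĥ(ξ') dξ` is given by an absolutely convergent integral,
is continuous on all of `ℝⁿ` — in particular it has no jump across `{x_n = 0}`, its lateral
limits from the two half-spaces coinciding with its restriction — and on the hyperplane
`u(x',0) = (2π)^{−(n−1)} ∫ e^{ix'·η} b(x',η) ĥ(η) dη`, where
`b(x',η) = (2π)⁻¹ ∫ a((x',0),(η,τ)) dτ` is the induced boundary symbol. -/
theorem layer_potential_no_jump_order_lt_neg_one (d : ℕ) (hd : 1 ≤ d)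
    (m : ℝ) (hm : m < -1) (C : ℝ) (hC : 0 ≤ C)
    (a : (Fin (d + 1) → ℝ) → (Fin (d + 1) → ℝ) → ℂ)
    (ha_cont : Continuous fun p : (Fin (d + 1) → ℝ) × (Fin (d + 1) → ℝ) => a p.1 p.2)
    (ha_bd : ∀ (x ξ : Fin (d + 1) → ℝ),
      ‖a x ξ‖ ≤ C * (1 + (∑ i, ξ i ^ 2)) ^ (m / 2))
    (h : SchwartzMap (Fin d → ℝ) ℂ) :
    (∀ x : Fin (d + 1) → ℝ,
      Integrable fun ξ : Fin (d + 1) → ℝ =>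
        Complex.exp (Complex.I * ((∑ i, x i * ξ i : ℝ) : ℂ)) * a x ξ *
          fTrans d (fun y => h y) (Fin.init ξ)) ∧
    Continuous (fun x : Fin (d + 1) → ℝ =>
      (((2 * Real.pi) ^ (d + 1) : ℝ) : ℂ)⁻¹ *
        ∫ ξ : Fin (d + 1) → ℝ,
          Complex.exp (Complex.I * ((∑ i, x i * ξ i : ℝ) : ℂ)) * a x ξ *
            fTrans d (fun y => h y) (Fin.init ξ)) ∧
    (∀ x' : Fin d → ℝ,
      (((2 * Real.pi) ^ (d + 1) : ℝ) : ℂ)⁻¹ *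
          (∫ ξ : Fin (d + 1) → ℝ,
            Complex.exp (Complex.I * ((∑ i, (Fin.snoc x' (0 : ℝ) : Fin (d + 1) → ℝ) i * ξ i : ℝ) : ℂ)) *
              a (Fin.snoc x' 0) ξ * fTrans d (fun y => h y) (Fin.init ξ)) =
        (((2 * Real.pi) ^ d : ℝ) : ℂ)⁻¹ *
          ∫ η : Fin d → ℝ,
            Complex.exp (Complex.I * ((∑ i, x' i * η i : ℝ) : ℂ)) *
              ((2 * Real.pi : ℂ)⁻¹ * ∫ τ : ℝ, a (Fin.snoc x' 0) (Fin.snoc η τ)) *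
              fTrans d (fun y => h y) η) := by
  obtain ⟨g, hg⟩ := fTrans_eq_schwartzMap d h
  simp only [hg]
  have hdom : Integrable fun ξ : Fin (d + 1) → ℝ =>
      C * ((1 + ξ (Fin.last d) ^ 2) ^ (m / 2) * ‖g (Fin.init ξ)‖) :=
    (integrable_rpow_last_mul_init hm g.integrable.norm).const_mul C
  have hcont : Continuous fun p : (Fin (d + 1) → ℝ) × (Fin (d + 1) → ℝ) =>
      Complex.exp (Complex.I * ((∑ i, p.1 i * p.2 i : ℝ) : ℂ)) * a p.1 p.2 *
        g (Fin.init p.2) := by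
    refine (Continuous.mul ?_ ha_cont).mul
      (g.continuous.comp ((continuous_fin_init d).comp continuous_snd))
    fun_prop
  have hint : ∀ x : Fin (d + 1) → ℝ, Integrable fun ξ : Fin (d + 1) → ℝ =>
      Complex.exp (Complex.I * ((∑ i, x i * ξ i : ℝ) : ℂ)) * a x ξ * g (Fin.init ξ) := fun x =>
    hdom.mono' (hcont.comp (Continuous.prodMk_right x)).aestronglyMeasurable
      (.of_forall (norm_layerIntegrand_le hm hC ha_bd g x))
  refine ⟨hint, continuous_const.mul ?_, fun x' => ?_⟩
  · have hcont' : ∀ ξ : Fin (d + 1) → ℝ, Continuous fun x : Fin (d + 1) → ℝ =>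
        Complex.exp (Complex.I * ((∑ i, x i * ξ i : ℝ) : ℂ)) * a x ξ * g (Fin.init ξ) := fun ξ => by
      have ha : Continuous fun x => a x ξ := ha_cont.comp (Continuous.prodMk_left ξ)
      fun_prop
    exact continuous_of_dominated (fun x => (hint x).aestronglyMeasurable)
      (fun x => .of_forall (norm_layerIntegrand_le hm hC ha_bd g x)) hdom (.of_forall hcont')
  · rw [integral_eq_integral_integral_snoc (hint (Fin.snoc x' 0)), ← integral_const_mul,
      ← integral_const_mul]
    refine integral_congr_ae (.of_forall fun η => ?_)
    simp only [Fin.sum_univ_castSucc, Fin.snoc_castSucc, Fin.snoc_last, zero_mul, add_zero,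
      Fin.init_snoc, integral_const_mul, integral_mul_const]
    push_cast
    rw [pow_succ, mul_inv]
    ring
end

section
/- Let n ≥ 2 and let a = b + r : ℝⁿ × ℝⁿ → ℂ be a classical symbol of order −1 with odd principal symbol (so b is a symbol of order −1 that is essentially homogeneous of degree −1 and odd for ‖ξ‖ ≥ 1, and r is a symbol of order −2). For (x, η, t) ∈ ℝⁿ × ℝ^{n−1} × ℝ let A(x, η, t) := lim_{R→∞} (2π)⁻¹ ∫_{−R}^{R} e^{itτ} a(x, (η, τ)) dτ (the limit exists). Let h : ℝ^{n−1} → ℂ be a Schwartz function with ĥ(η) := ∫_{ℝ^{n−1}} e^{−i y·η} h(y) dy, and for x' ∈ ℝ^{n−1}, t ∈ ℝ define u(x', t) := (2π)^{−(n−1)} ∫_{ℝ^{n−1}} e^{i x'·η} A((x', t), η, t) ĥ(η) dη and u₀(x') := (2π)^{−(n−1)} ∫_{ℝ^{n−1}} e^{i x'·η} A((x', 0), η, 0) ĥ(η) dη. Then these integrals converge absolutely, and for every x' ∈ ℝ^{n−1}: u(x', t) → (i/2)·b((x', 0), e_n)·h(x') + u₀(x') as t → 0⁺, and u(x', t) →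 −(i/2)·b((x', 0), e_n)·h(x') + u₀(x') as t → 0⁻. In particular the jump of the layer potential across {x_n = 0} equals i·b((x', 0), e_n)·h(x'). -/
open MeasureTheory Filter Topology

noncomputable section

/-- Iterated partial derivatives of `f : ℝ^k → ℂ` in the list of coordinate directions `L`. -/
def pderivList {k : ℕ} : List (Fin k) → ((Fin k → ℝ) → ℂ) → ((Fin k → ℝ) → ℂ)
  | [], f => f
  | i :: L, f => fun x => fderiv ℝ (pderivList L f) x (Pi.single i 1)

/-- The mixed derivative `∂_x^α ∂_ξ^β f(x, ξ)`. -/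
def mixedPDeriv {k l : ℕ} (α : List (Fin k)) (β : List (Fin l))
    (f : (Fin k → ℝ) → (Fin l → ℝ) → ℂ) (x : Fin k → ℝ) (ξ : Fin l → ℝ) : ℂ :=
  pderivList α (fun y => pderivList β (f y) ξ) x

/-- `a` is a (Kohn–Nirenberg) symbol of order `m` on `ℝ^k`. -/
def IsSymbol {k : ℕ} (m : ℝ) (a : (Fin k → ℝ) → (Fin k → ℝ) → ℂ) : Prop :=
  ContDiff ℝ (⊤ : ℕ∞) (fun p : (Fin k → ℝ) × (Fin k → ℝ) => a p.1 p.2) ∧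
  ∀ (α β : List (Fin k)), ∃ C : ℝ, 0 ≤ C ∧ ∀ (x ξ : Fin k → ℝ),
    ‖mixedPDeriv α β a x ξ‖ ≤ C * (1 + (∑ i, ξ i ^ 2)) ^ ((m - β.length) / 2)

/-- The Euclidean norm on `ℝ^k`. -/
def euclNorm {k : ℕ} (ξ : Fin k → ℝ) : ℝ := Real.sqrt (∑ i, ξ i ^ 2)

end

/-- The integral over `[0, R]` of `sin x * exp (-(s * x))`. -/
lemma integral_sin_mul_exp_neg_mul (s R : ℝ) :
    ∫ x in (0 : ℝ)..R, Real.sin x * Real.exp (-(s * x)) =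
      (1 + s ^ 2)⁻¹ - Real.exp (-(s * R)) * (Real.cos R + s * Real.sin R) * (1 + s ^ 2)⁻¹ := by
  have hs : (1 + s ^ 2) ≠ 0 := by positivity
  have hderiv : ∀ x ∈ Set.uIcc 0 R, HasDerivAt
      (fun x => -(Real.exp (-(s * x)) * (Real.cos x + s * Real.sin x) * (1 + s ^ 2)⁻¹))
      (Real.sin x * Real.exp (-(s * x))) x := by
    intro x _
    have h1 : HasDerivAt (fun x : ℝ => Real.exp (-(s * x))) (Real.exp (-(s * x)) * (-(s * 1))) x :=
      (((hasDerivAt_id x).const_mul s).neg).exp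
    have h2 : HasDerivAt (fun x : ℝ => Real.cos x + s * Real.sin x)
        (-Real.sin x + s * Real.cos x) x :=
      (Real.hasDerivAt_cos x).add ((Real.hasDerivAt_sin x).const_mul s)
    refine ((h1.mul h2).mul_const ((1 + s ^ 2)⁻¹)).neg.congr_deriv ?_
    field_simp
    ring
  rw [intervalIntegral.integral_eq_sub_of_hasDerivAt hderiv
    (Continuous.intervalIntegrable (by fun_prop) _ _)]
  simp
  ring

lemma integral_Ioi_sin_mul_exp_neg_mul {x : ℝ} (hx : 0 < x) :
    ∫ s in Set.Ioi (0 : ℝ), Real.sin x * Real.exp (-(s * x)) = Real.sinc x := by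
  have h := integral_exp_mul_Ioi (neg_lt_zero.mpr hx) 0
  have h' : ∀ s : ℝ, -(s * x) = -x * s := fun s => by ring
  simp_rw [h']
  rw [integral_const_mul, h, Real.sinc_apply, if_neg hx.ne']
  simp
  field_simp

lemma integrable_sin_mul_exp_neg_mul_prod (R : ℝ) :
    Integrable (Function.uncurry fun x s : ℝ => Real.sin x * Real.exp (-(s * x)))
      ((volume.restrict (Set.Ioc 0 R)).prod (volume.restrict (Set.Ioi 0))) := by
  have hexp_int : ∀ x : ℝ, 0 < x →
      IntegrableOn (fun s : ℝ => Real.exp (-(s * x))) (Set.Ioi 0) := by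
    intro x hx
    simpa [mul_comm] using integrableOn_exp_mul_Ioi (neg_lt_zero.mpr hx) 0
  rw [integrable_prod_iff (Continuous.aestronglyMeasurable (by
    simp only [Function.uncurry_def]; fun_prop))]
  constructor
  · filter_upwards [ae_restrict_mem measurableSet_Ioc] with x hx
    exact (hexp_int x hx.1).const_mul (Real.sin x)
  · refine Integrable.congr (f := fun x => |Real.sinc x|) ?_ ?_
    · exact (Real.continuous_sinc.abs.integrableOn_Icc (a := 0) (b := R)).mono_set
        Set.Ioc_subset_Icc_self
    · filter_upwards [ae_restrict_mem measurableSet_Ioc] with x hx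
      rw [← integral_Ioi_sin_mul_exp_neg_mul hx.1, integral_const_mul, abs_mul,
        abs_of_nonneg (integral_nonneg fun s => (Real.exp_pos _).le)]
      simp [Function.uncurry, integral_const_mul]

lemma integral_sinc_eq {R : ℝ} (hR : 0 < R) :
    ∫ x in (0 : ℝ)..R, Real.sinc x = ∫ s in Set.Ioi (0 : ℝ), ((1 + s ^ 2)⁻¹ -
      Real.exp (-(s * R)) * (Real.cos R + s * Real.sin R) * (1 + s ^ 2)⁻¹) := by
  rw [intervalIntegral.integral_of_le hR.le]
  have h1 : ∫ x in Set.Ioc 0 R, Real.sinc x =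
      ∫ x in Set.Ioc 0 R, ∫ s in Set.Ioi (0 : ℝ), Real.sin x * Real.exp (-(s * x)) :=
    setIntegral_congr_fun measurableSet_Ioc fun x hx =>
      (integral_Ioi_sin_mul_exp_neg_mul hx.1).symm
  rw [h1, integral_integral_swap (integrable_sin_mul_exp_neg_mul_prod R)]
  congr 1
  ext s
  rw [← intervalIntegral.integral_of_le hR.le, integral_sin_mul_exp_neg_mul]

lemma abs_integral_sinc_sub_le {R : ℝ} (hR : 0 < R) :
    |(∫ x in (0 : ℝ)..R, Real.sinc x) - Real.pi / 2| ≤ 2 / R := by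
  have hexp : IntegrableOn (fun s : ℝ => 2 * Real.exp (-R * s)) (Set.Ioi 0) :=
    (integrableOn_exp_mul_Ioi (neg_lt_zero.mpr hR) 0).const_mul 2
  have hbound : ∀ s : ℝ,
      ‖Real.exp (-(s * R)) * (Real.cos R + s * Real.sin R) * (1 + s ^ 2)⁻¹‖ ≤
        2 * Real.exp (-R * s) := by
    intro s
    have h1 : |Real.cos R + s * Real.sin R| ≤ 2 * (1 + s ^ 2) := by
      have hc := Real.abs_cos_le_one R
      have hs := Real.abs_sin_le_one R
      calc |Real.cos R + s * Real.sin R| ≤ |Real.cos R| + |s| * |Real.sin R| := by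
            rw [← abs_mul]; exact abs_add_le _ _
        _ ≤ 1 + |s| * 1 := by gcongr
        _ ≤ 2 * (1 + s ^ 2) := by nlinarith [sq_abs s, sq_nonneg (|s| - 1)]
    have h2 : (0 : ℝ) < 1 + s ^ 2 := by positivity
    rw [norm_mul, norm_mul, Real.norm_eq_abs, Real.norm_eq_abs, Real.norm_eq_abs,
      abs_of_pos (Real.exp_pos _), abs_of_pos (inv_pos.mpr h2), ← div_eq_mul_inv, div_le_iff₀ h2,
      show -R * s = -(s * R) by ring]
    nlinarith [mul_le_mul_of_nonneg_left h1 (Real.exp_pos (-(s * R))).le]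
  have hexp_int : IntegrableOn
      (fun s : ℝ => Real.exp (-(s * R)) * (Real.cos R + s * Real.sin R) * (1 + s ^ 2)⁻¹)
      (Set.Ioi 0) := by
    refine hexp.mono' ?_ (Eventually.of_forall hbound)
    have hc : Continuous fun s : ℝ => (1 + s ^ 2)⁻¹ :=
      Continuous.inv₀ (by fun_prop) fun s => by positivity
    exact Continuous.aestronglyMeasurable (by fun_prop)
  rw [integral_sinc_eq hR, integral_sub integrable_inv_one_add_sq.integrableOn hexp_int,
    integral_Ioi_inv_one_add_sq, Real.arctan_zero, sub_zero, sub_sub_cancel_left, abs_neg,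
    ← Real.norm_eq_abs]
  refine (norm_integral_le_of_norm_le hexp (Eventually.of_forall hbound)).trans ?_
  rw [integral_const_mul, integral_exp_mul_Ioi (neg_lt_zero.mpr hR)]
  simp
  field_simp
  rfl

/-- The Dirichlet integral. -/
lemma tendsto_integral_sinc_atTop :
    Tendsto (fun R : ℝ => ∫ x in (0 : ℝ)..R, Real.sinc x) atTop (𝓝 (Real.pi / 2)) := by
  rw [tendsto_iff_norm_sub_tendsto_zero]
  refine squeeze_zero' (Eventually.of_forall fun _ => norm_nonneg _) ?_
    (tendsto_const_nhds.div_atTop tendsto_id : Tendsto (fun R : ℝ => 2 / R) atTop (𝓝 0))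
  filter_upwards [eventually_gt_atTop 0] with R hR
  exact abs_integral_sinc_sub_le hR

lemma intervalIntegral_neg_self_eq_add {E : Type*} [NormedAddCommGroup E] [NormedSpace ℝ E]
    {f : ℝ → E} (hf : Continuous f) (R : ℝ) :
    ∫ x in (-R)..R, f x = ∫ x in (0 : ℝ)..R, (f x + f (-x)) := by
  have hneg : Continuous fun x => f (-x) := by fun_prop
  rw [intervalIntegral.integral_add (hf.intervalIntegrable _ _) (hneg.intervalIntegrable _ _),
    intervalIntegral.integral_comp_neg, neg_zero, add_comm,
    intervalIntegral.integral_add_adjacent_intervals (hf.intervalIntegrable _ _)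
      (hf.intervalIntegrable _ _)]

lemma tendsto_integral_mul_sinc_mul (t : ℝ) :
    Tendsto (fun R : ℝ => ∫ x in (0 : ℝ)..R, t * Real.sinc (t * x)) atTop
      (𝓝 (Real.pi / 2 * Real.sign t)) := by
  have hsub : ∀ t R : ℝ, ∫ x in (0 : ℝ)..R, t * Real.sinc (t * x) =
      ∫ x in (0 : ℝ)..t * R, Real.sinc x := by
    intro t R
    rw [intervalIntegral.integral_const_mul, intervalIntegral.mul_integral_comp_mul_left, mul_zero]
  have hpos : ∀ t : ℝ, 0 < t → Tendsto (fun R : ℝ => ∫ x in (0 : ℝ)..R, t * Real.sinc (t * x))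
      atTop (𝓝 (Real.pi / 2)) := by
    intro t ht
    simp_rw [hsub]
    exact tendsto_integral_sinc_atTop.comp (tendsto_id.const_mul_atTop ht)
  rcases lt_trichotomy t 0 with ht | rfl | ht
  · have h := (hpos (-t) (neg_pos.mpr ht)).neg
    simpa [Real.sign_of_neg ht, Real.sinc_neg] using h
  · simp
  · simpa [Real.sign_of_pos ht] using hpos t ht

lemma continuous_inv_one_add_sq : Continuous fun x : ℝ => (1 + x ^ 2)⁻¹ :=
  Continuous.inv₀ (by fun_prop) fun s => by positivity

/-- The Fourier transform, as a principal value, of `τ ↦ τ / (1 + τ²)`. -/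
noncomputable def oddKernelTransform (t : ℝ) : ℂ :=
  Complex.I * ((Real.pi * Real.sign t -
    2 * t * ∫ x in Set.Ioi (0 : ℝ), Real.sinc (t * x) * (1 + x ^ 2)⁻¹ : ℝ) : ℂ)

lemma oddKernelTransform_zero : oddKernelTransform 0 = 0 := by simp [oddKernelTransform]

lemma abs_sinc_mul_inv_le (t x : ℝ) :
    ‖Real.sinc (t * x) * (1 + x ^ 2)⁻¹‖ ≤ (1 + x ^ 2)⁻¹ := by
  have h2 : (0 : ℝ) < (1 + x ^ 2)⁻¹ := by positivity
  rw [norm_mul, Real.norm_of_nonneg h2.le]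
  exact mul_le_of_le_one_left h2.le (Real.abs_sinc_le_one _)

lemma integrable_sinc_mul_inv (t : ℝ) :
    Integrable fun x : ℝ => Real.sinc (t * x) * (1 + x ^ 2)⁻¹ := by
  refine integrable_inv_one_add_sq.mono' ?_ (Eventually.of_forall (abs_sinc_mul_inv_le t))
  exact ((Real.continuous_sinc.comp (continuous_const_mul t)).mul
    continuous_inv_one_add_sq).aestronglyMeasurable

lemma tendsto_oddKernelTransform (t : ℝ) :
    Tendsto (fun R : ℝ => ∫ τ in (-R)..R,
      Complex.exp (Complex.I * (t : ℂ) * (τ : ℂ)) * ((τ * (1 + τ ^ 2)⁻¹ : ℝ) : ℂ)) atTop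
      (𝓝 (oddKernelTransform t)) := by
  have hk : Continuous fun τ : ℝ => τ * (1 + τ ^ 2)⁻¹ :=
    continuous_id.mul continuous_inv_one_add_sq
  have hs : Continuous fun τ : ℝ => Real.sinc (t * τ) :=
    Real.continuous_sinc.comp (continuous_const_mul t)
  have hcont : Continuous fun τ : ℝ =>
      Complex.exp (Complex.I * (t : ℂ) * (τ : ℂ)) * ((τ * (1 + τ ^ 2)⁻¹ : ℝ) : ℂ) :=
    (by fun_prop : Continuous fun τ : ℝ => Complex.exp (Complex.I * (t : ℂ) * (τ : ℂ))).mul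
      (Complex.continuous_ofReal.comp hk)
  have hpt : ∀ τ : ℝ,
      Complex.exp (Complex.I * (t : ℂ) * (τ : ℂ)) * ((τ * (1 + τ ^ 2)⁻¹ : ℝ) : ℂ) +
        Complex.exp (Complex.I * (t : ℂ) * ((-τ : ℝ) : ℂ)) *
          (((-τ) * (1 + (-τ) ^ 2)⁻¹ : ℝ) : ℂ) =
      Complex.I * ((2 * (t * Real.sinc (t * τ)) -
        2 * t * (Real.sinc (t * τ) * (1 + τ ^ 2)⁻¹) : ℝ) : ℂ) := by
    intro τ
    have h0 : (1 + τ ^ 2 : ℝ) ≠ 0 := by positivity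
    have hsin : t * τ * Real.sinc (t * τ) = Real.sin (t * τ) := by
      rcases eq_or_ne (t * τ) 0 with h | h
      · simp [h]
      · rw [Real.sinc_apply, if_neg h, mul_div_cancel₀ _ h]
    have hreal : 2 * (t * Real.sinc (t * τ)) - 2 * t * (Real.sinc (t * τ) * (1 + τ ^ 2)⁻¹) =
        2 * Real.sin (t * τ) * (τ * (1 + τ ^ 2)⁻¹) := by
      rw [← hsin]; field_simp; ring
    have e1 : Complex.I * (t : ℂ) * (τ : ℂ) = ((t * τ : ℝ) : ℂ) * Complex.I := by
      push_cast; ring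
    have e2 : Complex.I * (t : ℂ) * ((-τ : ℝ) : ℂ) = ((-(t * τ) : ℝ) : ℂ) * Complex.I := by
      push_cast; ring
    rw [hreal, e1, e2, Complex.exp_mul_I, Complex.exp_mul_I, ← Complex.ofReal_cos,
      ← Complex.ofReal_sin, ← Complex.ofReal_cos, ← Complex.ofReal_sin, Real.cos_neg,
      Real.sin_neg, neg_sq]
    push_cast
    ring
  have hR : ∀ R : ℝ, ∫ τ in (-R)..R,
      Complex.exp (Complex.I * (t : ℂ) * (τ : ℂ)) * ((τ * (1 + τ ^ 2)⁻¹ : ℝ) : ℂ) =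
      Complex.I * ((2 * (∫ x in (0 : ℝ)..R, t * Real.sinc (t * x)) -
        2 * t * ∫ x in (0 : ℝ)..R, Real.sinc (t * x) * (1 + x ^ 2)⁻¹ : ℝ) : ℂ) := by
    intro R
    rw [intervalIntegral_neg_self_eq_add hcont]
    simp_rw [hpt]
    rw [intervalIntegral.integral_const_mul, intervalIntegral.integral_ofReal,
      intervalIntegral.integral_sub, intervalIntegral.integral_const_mul (2 : ℝ),
      intervalIntegral.integral_const_mul (2 * t)]
    · exact ((hs.const_mul t).const_mul 2).intervalIntegrable _ _
    · exact ((integrable_sinc_mul_inv t).const_mul _).intervalIntegrable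
  simp_rw [hR]
  refine Tendsto.const_mul _ ((Complex.continuous_ofReal.tendsto _).comp (Tendsto.sub ?_ ?_))
  · convert (tendsto_integral_mul_sinc_mul t).const_mul 2 using 2
    ring
  · exact (intervalIntegral_tendsto_integral_Ioi 0 (integrable_sinc_mul_inv t).integrableOn
      tendsto_id).const_mul _

lemma tendsto_oddKernelTransform_side {l : Filter ℝ} (hl : l ≤ 𝓝 0) {σ : ℝ}
    (hσ : ∀ᶠ t in l, Real.sign t = σ) :
    Tendsto oddKernelTransform l (𝓝 (Complex.I * (Real.pi * σ : ℝ))) := by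
  refine Tendsto.const_mul _ ((Complex.continuous_ofReal.tendsto _).comp ?_)
  have h1 : Tendsto (fun t : ℝ =>
      2 * t * ∫ x in Set.Ioi (0 : ℝ), Real.sinc (t * x) * (1 + x ^ 2)⁻¹) l (𝓝 0) := by
    have hb : Tendsto (fun t : ℝ => ‖2 * t‖ * ∫ x in Set.Ioi (0 : ℝ), (1 + x ^ 2)⁻¹) l (𝓝 0) := by
      have hc : Continuous fun t : ℝ => ‖2 * t‖ * ∫ x in Set.Ioi (0 : ℝ), (1 + x ^ 2)⁻¹ := by
        fun_prop
      simpa using (hc.tendsto 0).mono_left hl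
    refine squeeze_zero_norm (fun t => ?_) hb
    rw [norm_mul]
    gcongr
    exact norm_integral_le_of_norm_le integrable_inv_one_add_sq.integrableOn
      (Eventually.of_forall (abs_sinc_mul_inv_le t))
  have h2 : Tendsto (fun t : ℝ => Real.pi * Real.sign t) l (𝓝 (Real.pi * σ)) :=
    tendsto_const_nhds.congr' (hσ.mono fun t ht => by simp only [ht])
  simpa using h2.sub h1

/-- The density `h`, transported to Euclidean space. -/
noncomputable def toEuclideanSchwartz {d : ℕ} (h : SchwartzMap (Fin d → ℝ) ℂ) :
    SchwartzMap (EuclideanSpace ℝ (Fin d)) ℂ :=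
  SchwartzMap.compCLMOfContinuousLinearEquiv ℂ (EuclideanSpace.equiv (Fin d) ℝ) h

lemma toEuclideanSchwartz_apply {d : ℕ} (h : SchwartzMap (Fin d → ℝ) ℂ)
    (v : EuclideanSpace ℝ (Fin d)) : toEuclideanSchwartz h v = h v.ofLp := rfl

lemma fTrans_eq_fourier {d : ℕ} (h : SchwartzMap (Fin d → ℝ) ℂ) (η : Fin d → ℝ) :
    fTrans d (fun y => h y) ((2 * Real.pi) • η) =
      FourierTransform.fourier (toEuclideanSchwartz h : EuclideanSpace ℝ (Fin d) → ℂ)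
        (WithLp.toLp 2 η) := by
  rw [Real.fourier_eq', ← (PiLp.volume_preserving_toLp (Fin d)).integral_comp
    (MeasurableEquiv.toLp 2 (Fin d → ℝ)).measurableEmbedding]
  refine integral_congr_ae (Eventually.of_forall fun y => ?_)
  simp only [toEuclideanSchwartz_apply, PiLp.inner_apply, smul_eq_mul, Pi.smul_apply]
  congr 2
  have : ∑ i, y i * (2 * Real.pi * η i) = 2 * Real.pi * ∑ i, y i * η i := by
    rw [Finset.mul_sum]; exact Finset.sum_congr rfl fun i _ => by ring
  rw [this]
  have h2 : ∑ i, inner ℝ (y i) (η i) = ∑ i, y i * η i :=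
    Finset.sum_congr rfl fun i _ => by simp [mul_comm]
  rw [h2]
  push_cast
  ring

lemma exists_schwartzMap_eq_fTrans {d : ℕ} (h : SchwartzMap (Fin d → ℝ) ℂ) :
    ∃ F : SchwartzMap (Fin d → ℝ) ℂ, ∀ η, F η = fTrans d (fun y => h y) η := by
  have hpi : (2 * Real.pi)⁻¹ ≠ 0 := by positivity
  let e : (Fin d → ℝ) ≃L[ℝ] EuclideanSpace ℝ (Fin d) :=
    (ContinuousLinearEquiv.smulLeft (Units.mk0 _ hpi)).trans (EuclideanSpace.equiv (Fin d) ℝ).symm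
  refine ⟨SchwartzMap.compCLMOfContinuousLinearEquiv ℂ e
    (FourierTransform.fourier (toEuclideanSchwartz h)), fun η => ?_⟩
  have h1 : η = (2 * Real.pi) • ((2 * Real.pi)⁻¹ • η) := by
    rw [smul_smul, mul_inv_cancel₀ (by positivity), one_smul]
  conv_rhs => rw [h1, fTrans_eq_fourier]
  rfl

/-- Fourier inversion, with the normalization of `fTrans`. -/
lemma integral_exp_mul_fTrans {d : ℕ} (h : SchwartzMap (Fin d → ℝ) ℂ) (x : Fin d → ℝ) :
    (((2 * Real.pi) ^ d : ℝ) : ℂ)⁻¹ * ∫ η : Fin d → ℝ,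
      Complex.exp (Complex.I * ((∑ i, x i * η i : ℝ) : ℂ)) * fTrans d (fun y => h y) η = h x := by
  have hinv : FourierTransformInv.fourierInv (FourierTransform.fourier (toEuclideanSchwartz h))
      (WithLp.toLp 2 x) = h x := by
    simp [toEuclideanSchwartz_apply]
  have hs := Measure.integral_comp_smul (volume : Measure (Fin d → ℝ))
    (fun η => Complex.exp (Complex.I * ((∑ i, x i * η i : ℝ) : ℂ)) * fTrans d (fun y => h y) η)
    (2 * Real.pi)
  rw [Module.finrank_fin_fun, abs_of_pos (by positivity), Complex.real_smul] at hs
  rw [← Complex.ofReal_inv, ← hs, ← hinv, SchwartzMap.fourierInv_coe, Real.fourierInv_eq',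
    ← (PiLp.volume_preserving_toLp (Fin d)).integral_comp
    (MeasurableEquiv.toLp 2 (Fin d → ℝ)).measurableEmbedding]
  refine integral_congr_ae (Eventually.of_forall fun y => ?_)
  simp only [fTrans_eq_fourier, PiLp.inner_apply, smul_eq_mul, Pi.smul_apply,
    SchwartzMap.fourier_coe]
  congr 2
  have : ∑ i, x i * (2 * Real.pi * y i) = 2 * Real.pi * ∑ i, x i * y i := by
    rw [Finset.mul_sum]; exact Finset.sum_congr rfl fun i _ => by ring
  rw [this]
  have h2 : ∑ i, inner ℝ (y i) (x i) = ∑ i, x i * y i :=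
    Finset.sum_congr rfl fun i _ => by simp
  rw [h2]
  push_cast
  ring

lemma IsSymbol.contDiff_right {k : ℕ} {m : ℝ} {a : (Fin k → ℝ) → (Fin k → ℝ) → ℂ}
    (ha : IsSymbol m a) (x : Fin k → ℝ) : ContDiff ℝ (⊤ : ℕ∞) (a x) :=
  ha.1.comp (contDiff_const.prodMk contDiff_id)

lemma IsSymbol.norm_le {k : ℕ} {m : ℝ} {a : (Fin k → ℝ) → (Fin k → ℝ) → ℂ}
    (ha : IsSymbol m a) : ∃ C : ℝ, 0 ≤ C ∧ ∀ x ξ : Fin k → ℝ,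
      ‖a x ξ‖ ≤ C * (1 + ∑ i, ξ i ^ 2) ^ (m / 2) := by
  simpa [mixedPDeriv, pderivList] using ha.2 [] []

lemma IsSymbol.norm_fderiv_apply_le {k : ℕ} {m : ℝ} {a : (Fin k → ℝ) → (Fin k → ℝ) → ℂ}
    (ha : IsSymbol m a) : ∃ C : ℝ, 0 ≤ C ∧ ∀ x ξ v : Fin k → ℝ,
      ‖fderiv ℝ (a x) ξ v‖ ≤ C * ‖v‖ * (1 + ∑ i, ξ i ^ 2) ^ ((m - 1) / 2) := by
  have h : ∀ i : Fin k, ∃ C : ℝ, 0 ≤ C ∧ ∀ x ξ : Fin k → ℝ,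
      ‖fderiv ℝ (a x) ξ (Pi.single i 1)‖ ≤ C * (1 + ∑ i, ξ i ^ 2) ^ ((m - 1) / 2) := fun i => by
    simpa [mixedPDeriv, pderivList] using ha.2 [] [i]
  choose C hC0 hC using h
  refine ⟨∑ i, C i, Finset.sum_nonneg fun i _ => hC0 i, fun x ξ v => ?_⟩
  have hv : v = ∑ i, v i • (Pi.single i 1 : Fin k → ℝ) := pi_eq_sum_univ' v
  conv_lhs => rw [hv, map_sum]
  rw [Finset.sum_mul, Finset.sum_mul]
  refine norm_sum_le_of_le _ fun i _ => ?_
  rw [map_smul, norm_smul, mul_comm (C i), mul_assoc]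
  gcongr
  · exact norm_le_pi_norm v i
  · exact hC i x ξ

lemma sum_snoc_sq {d : ℕ} (η : Fin d → ℝ) (τ : ℝ) :
    ∑ i, (Fin.snoc η τ : Fin (d + 1) → ℝ) i ^ 2 = ∑ i, η i ^ 2 + τ ^ 2 := by
  simp [Fin.sum_univ_castSucc]

lemma rpow_neg_one_sum_snoc_le {d : ℕ} (η : Fin d → ℝ) (τ : ℝ) :
    (1 + ∑ i, (Fin.snoc η τ : Fin (d + 1) → ℝ) i ^ 2) ^ (-1 : ℝ) ≤ (1 + τ ^ 2)⁻¹ := by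
  rw [Real.rpow_neg_one, sum_snoc_sq]
  have : 0 ≤ ∑ i, η i ^ 2 := Finset.sum_nonneg fun i _ => sq_nonneg _
  gcongr
  linarith

lemma continuous_snoc {d : ℕ} :
    Continuous fun p : (Fin d → ℝ) × ℝ => (Fin.snoc p.1 p.2 : Fin (d + 1) → ℝ) :=
  Continuous.finSnoc (A := fun _ => ℝ) continuous_fst continuous_snd

lemma norm_snoc_zero {d : ℕ} (η : Fin d → ℝ) :
    ‖(Fin.snoc η 0 : Fin (d + 1) → ℝ)‖ ≤ ‖η‖ := by
  rw [pi_norm_le_iff_of_nonneg (norm_nonneg _)]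
  intro i
  refine Fin.lastCases ?_ (fun j => ?_) i
  · simp
  · simpa using norm_le_pi_norm η j

lemma snoc_zero_add_smul {d : ℕ} (η : Fin d → ℝ) (τ s : ℝ) :
    (Fin.snoc 0 τ + s • Fin.snoc η 0 : Fin (d + 1) → ℝ) = Fin.snoc (s • η) τ := by
  ext i
  refine Fin.lastCases ?_ (fun j => ?_) i <;> simp

lemma snoc_zero_eq_smul {d : ℕ} (τ : ℝ) :
    (Fin.snoc 0 τ : Fin (d + 1) → ℝ) = τ • Fin.snoc (0 : Fin d → ℝ) 1 := by
  ext i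
  refine Fin.lastCases ?_ (fun j => ?_) i <;> simp

/-- Freezing the tangential covariable at `0` costs one order of decay in the normal one. -/
lemma IsSymbol.norm_sub_snoc_zero_le {d : ℕ} {b : (Fin (d + 1) → ℝ) → (Fin (d + 1) → ℝ) → ℂ}
    (hb : IsSymbol (-1) b) : ∃ C : ℝ, 0 ≤ C ∧ ∀ x (η : Fin d → ℝ) (τ : ℝ),
      ‖b x (Fin.snoc η τ) - b x (Fin.snoc 0 τ)‖ ≤ C * ‖η‖ * (1 + τ ^ 2)⁻¹ := by
  obtain ⟨C, hC0, hC⟩ := hb.norm_fderiv_apply_le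
  refine ⟨C, hC0, fun x η τ => ?_⟩
  have hd : ∀ s : ℝ, HasDerivAt (fun s : ℝ => b x (Fin.snoc (s • η) τ))
      (fderiv ℝ (b x) (Fin.snoc (s • η) τ) (Fin.snoc η 0)) s := by
    intro s
    have h1 : HasDerivAt (fun s : ℝ => (Fin.snoc 0 τ + s • Fin.snoc η 0 : Fin (d + 1) → ℝ))
        (Fin.snoc η 0) s := by
      simpa using ((hasDerivAt_id s).smul_const (Fin.snoc η 0 : Fin (d + 1) → ℝ)).const_add
        (Fin.snoc 0 τ)
    simp_rw [snoc_zero_add_smul] at h1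
    exact (((hb.contDiff_right x).differentiable (by simp) _).hasFDerivAt).comp_hasDerivAt s h1
  have hbd : ∀ s : ℝ, ‖fderiv ℝ (b x) (Fin.snoc (s • η) τ) (Fin.snoc η 0)‖ ≤
      C * ‖η‖ * (1 + τ ^ 2)⁻¹ := by
    intro s
    refine (hC x _ _).trans ?_
    rw [show ((-1 : ℝ) - 1) / 2 = -1 by norm_num]
    gcongr
    · exact norm_snoc_zero η
    · exact rpow_neg_one_sum_snoc_le _ τ
  have := norm_image_sub_le_of_norm_deriv_le_segment_01' (f := fun s : ℝ => b x (Fin.snoc (s • η) τ))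
    (fun s _ => (hd s).hasDerivWithinAt) (fun s _ => hbd s)
  simpa using this

lemma apply_snoc_zero_eq {d : ℕ} {b : (Fin (d + 1) → ℝ) → (Fin (d + 1) → ℝ) → ℂ}
    (hb_hom : ∀ (x ξ : Fin (d + 1) → ℝ) (lam : ℝ), 0 < lam →
      1 ≤ euclNorm ξ → 1 ≤ lam * euclNorm ξ → b x (lam • ξ) = (lam : ℂ)⁻¹ * b x ξ)
    (hb_odd : ∀ (x ξ : Fin (d + 1) → ℝ), 1 ≤ euclNorm ξ → b x (-ξ) = -b x ξ)
    (x : Fin (d + 1) → ℝ) {τ : ℝ} (hτ : 1 ≤ |τ|) :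
    b x (Fin.snoc 0 τ) = (τ : ℂ)⁻¹ * b x (Fin.snoc (0 : Fin d → ℝ) 1) := by
  have hn : ∀ σ : ℝ, euclNorm (Fin.snoc (0 : Fin d → ℝ) σ : Fin (d + 1) → ℝ) = |σ| := by
    intro σ
    rw [euclNorm, sum_snoc_sq]
    simp [Real.sqrt_sq_eq_abs]
  have hpos : ∀ σ : ℝ, 1 ≤ σ →
      b x (Fin.snoc 0 σ) = (σ : ℂ)⁻¹ * b x (Fin.snoc (0 : Fin d → ℝ) 1) := by
    intro σ hσ
    rw [snoc_zero_eq_smul, hb_hom x _ σ (by linarith) (by simp [hn]) (by simpa [hn] using hσ)]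
  rcases le_abs'.mp hτ with h | h
  · have h1 : (Fin.snoc 0 τ : Fin (d + 1) → ℝ) = -Fin.snoc (0 : Fin d → ℝ) (-τ) := by
      rw [snoc_zero_eq_smul, snoc_zero_eq_smul (-τ), neg_smul, neg_neg]
    rw [h1, hb_odd x _ (by rw [hn, abs_neg]; exact hτ), hpos (-τ) (by linarith)]
    push_cast
    rw [inv_neg, neg_mul, neg_neg]
  · exact hpos τ h

/-- The part of the symbol left after removing the odd kernel `τ / (1 + τ²)`. -/
noncomputable def symbolRemainder {d : ℕ} (b r : (Fin (d + 1) → ℝ) → (Fin (d + 1) → ℝ) → ℂ)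
    (x : Fin (d + 1) → ℝ) (η : Fin d → ℝ) (τ : ℝ) : ℂ :=
  b x (Fin.snoc η τ) + r x (Fin.snoc η τ) -
    b x (Fin.snoc (0 : Fin d → ℝ) 1) * ((τ * (1 + τ ^ 2)⁻¹ : ℝ) : ℂ)

lemma norm_apply_snoc_zero_sub_le {d : ℕ} {b : (Fin (d + 1) → ℝ) → (Fin (d + 1) → ℝ) → ℂ}
    (hb_hom : ∀ (x ξ : Fin (d + 1) → ℝ) (lam : ℝ), 0 < lam →
      1 ≤ euclNorm ξ → 1 ≤ lam * euclNorm ξ → b x (lam • ξ) = (lam : ℂ)⁻¹ * b x ξ)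
    (hb_odd : ∀ (x ξ : Fin (d + 1) → ℝ), 1 ≤ euclNorm ξ → b x (-ξ) = -b x ξ)
    {C : ℝ} (hC : ∀ x ξ, ‖b x ξ‖ ≤ C) (x : Fin (d + 1) → ℝ) (τ : ℝ) :
    ‖b x (Fin.snoc 0 τ) - b x (Fin.snoc (0 : Fin d → ℝ) 1) * ((τ * (1 + τ ^ 2)⁻¹ : ℝ) : ℂ)‖ ≤
      4 * C * (1 + τ ^ 2)⁻¹ := by
  have hC0 : 0 ≤ C := (norm_nonneg _).trans (hC 0 0)
  have hp : (0 : ℝ) < 1 + τ ^ 2 := by positivity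
  rcases le_total 1 |τ| with h | h
  · have hτ : τ ≠ 0 := by rintro rfl; norm_num at h
    rw [apply_snoc_zero_eq hb_hom hb_odd x h]
    have e : (τ : ℂ)⁻¹ * b x (Fin.snoc (0 : Fin d → ℝ) 1) -
        b x (Fin.snoc (0 : Fin d → ℝ) 1) * ((τ * (1 + τ ^ 2)⁻¹ : ℝ) : ℂ) =
        b x (Fin.snoc (0 : Fin d → ℝ) 1) * ((τ⁻¹ * (1 + τ ^ 2)⁻¹ : ℝ) : ℂ) := by
      have : τ⁻¹ - τ * (1 + τ ^ 2)⁻¹ = τ⁻¹ * (1 + τ ^ 2)⁻¹ := by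
        field_simp
        ring
      rw [← this]
      push_cast
      ring
    rw [e, norm_mul, Complex.norm_real, norm_mul, norm_inv, Real.norm_eq_abs,
      Real.norm_of_nonneg (inv_pos.mpr hp).le, ← mul_assoc]
    exact mul_le_mul_of_nonneg_right ((mul_le_mul (hC _ _) (inv_le_one_of_one_le₀ h)
      (by positivity) hC0).trans (by linarith)) (inv_pos.mpr hp).le
  · have h1 : (1 : ℝ) ≤ 2 * (1 + τ ^ 2)⁻¹ := by
      rw [← div_eq_mul_inv, le_div_iff₀ hp]
      nlinarith [sq_abs τ, abs_nonneg τ]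
    have h2 : ‖((τ * (1 + τ ^ 2)⁻¹ : ℝ) : ℂ)‖ ≤ 1 := by
      rw [Complex.norm_real, norm_mul, Real.norm_eq_abs, Real.norm_of_nonneg (inv_pos.mpr hp).le]
      exact mul_le_one₀ h (inv_pos.mpr hp).le (inv_le_one_of_one_le₀ (by nlinarith [sq_nonneg τ]))
    calc _ ≤ ‖b x (Fin.snoc 0 τ)‖ +
          ‖b x (Fin.snoc (0 : Fin d → ℝ) 1)‖ * ‖((τ * (1 + τ ^ 2)⁻¹ : ℝ) : ℂ)‖ := by
          rw [← norm_mul]; exact norm_sub_le _ _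
      _ ≤ C + C * 1 := by gcongr <;> exact hC _ _
      _ = 2 * C * 1 := by ring
      _ ≤ 2 * C * (2 * (1 + τ ^ 2)⁻¹) := by gcongr
      _ = _ := by ring

lemma IsSymbol.exists_norm_le {k : ℕ} {m : ℝ} (hm : m ≤ 0)
    {a : (Fin k → ℝ) → (Fin k → ℝ) → ℂ} (ha : IsSymbol m a) :
    ∃ C : ℝ, 0 ≤ C ∧ ∀ x ξ : Fin k → ℝ, ‖a x ξ‖ ≤ C := by
  obtain ⟨C, hC0, hC⟩ := ha.norm_le
  refine ⟨C, hC0, fun x ξ => (hC x ξ).trans (mul_le_of_le_one_right hC0 ?_)⟩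
  refine Real.rpow_le_one_of_one_le_of_nonpos ?_ (by linarith)
  have : 0 ≤ ∑ i, ξ i ^ 2 := Finset.sum_nonneg fun i _ => sq_nonneg _
  linarith

lemma exists_norm_symbolRemainder_le {d : ℕ}
    {b r : (Fin (d + 1) → ℝ) → (Fin (d + 1) → ℝ) → ℂ}
    (hb : IsSymbol (-1) b) (hr : IsSymbol (-2) r)
    (hb_hom : ∀ (x ξ : Fin (d + 1) → ℝ) (lam : ℝ), 0 < lam →
      1 ≤ euclNorm ξ → 1 ≤ lam * euclNorm ξ → b x (lam • ξ) = (lam : ℂ)⁻¹ * b x ξ)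
    (hb_odd : ∀ (x ξ : Fin (d + 1) → ℝ), 1 ≤ euclNorm ξ → b x (-ξ) = -b x ξ) :
    ∃ C : ℝ, 0 ≤ C ∧ ∀ x η τ,
      ‖symbolRemainder b r x η τ‖ ≤ C * (1 + ‖η‖) * (1 + τ ^ 2)⁻¹ := by
  obtain ⟨C₁, hC₁0, hC₁⟩ := hb.norm_sub_snoc_zero_le
  obtain ⟨C₂, hC₂0, hC₂⟩ := hb.exists_norm_le (by norm_num)
  obtain ⟨C₃, hC₃0, hC₃⟩ := hr.norm_le
  refine ⟨C₁ + 4 * C₂ + C₃, by positivity, fun x η τ => ?_⟩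
  have h3 : ‖r x (Fin.snoc η τ)‖ ≤ C₃ * (1 + τ ^ 2)⁻¹ := by
    refine (hC₃ x _).trans ?_
    rw [show (-2 : ℝ) / 2 = -1 by norm_num]
    gcongr
    exact rpow_neg_one_sum_snoc_le η τ
  have e : symbolRemainder b r x η τ = (b x (Fin.snoc η τ) - b x (Fin.snoc 0 τ)) +
      (b x (Fin.snoc 0 τ) - b x (Fin.snoc (0 : Fin d → ℝ) 1) * ((τ * (1 + τ ^ 2)⁻¹ : ℝ) : ℂ)) +
      r x (Fin.snoc η τ) := by
    rw [symbolRemainder]; ring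
  rw [e]
  refine (norm_add₃_le.trans (add_le_add_three (hC₁ x η τ)
    (norm_apply_snoc_zero_sub_le hb_hom hb_odd hC₂ x τ) h3)).trans ?_
  rw [← add_mul, ← add_mul]
  gcongr
  nlinarith [norm_nonneg η, mul_nonneg hC₂0 (norm_nonneg η), mul_nonneg hC₃0 (norm_nonneg η)]

lemma continuous_symbolRemainder {d : ℕ} {b r : (Fin (d + 1) → ℝ) → (Fin (d + 1) → ℝ) → ℂ}
    {m m' : ℝ} (hb : IsSymbol m b) (hr : IsSymbol m' r) :
    Continuous fun p : (Fin (d + 1) → ℝ) × (Fin d → ℝ) × ℝ =>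
      symbolRemainder b r p.1 p.2.1 p.2.2 := by
  have hs : Continuous fun p : (Fin (d + 1) → ℝ) × (Fin d → ℝ) × ℝ =>
      (p.1, (Fin.snoc p.2.1 p.2.2 : Fin (d + 1) → ℝ)) :=
    continuous_fst.prodMk (continuous_snoc.comp continuous_snd)
  have hk : Continuous fun τ : ℝ => τ * (1 + τ ^ 2)⁻¹ :=
    continuous_id.mul continuous_inv_one_add_sq
  have hc : Continuous fun p : (Fin (d + 1) → ℝ) × (Fin d → ℝ) × ℝ =>
      (p.1, (Fin.snoc (0 : Fin d → ℝ) 1 : Fin (d + 1) → ℝ)) :=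
    continuous_fst.prodMk continuous_const
  exact ((hb.1.continuous.comp hs).add (hr.1.continuous.comp hs)).sub
    ((hb.1.continuous.comp hc).mul
      (Complex.continuous_ofReal.comp (hk.comp (continuous_snd.comp continuous_snd))))

lemma norm_exp_I_mul_ofReal_mul_ofReal (t τ : ℝ) :
    ‖Complex.exp (Complex.I * (t : ℂ) * (τ : ℂ))‖ = 1 := by
  rw [mul_assoc, ← Complex.ofReal_mul, Complex.norm_exp_I_mul_ofReal]

/-- The Fourier transform of `symbolRemainder` in the normal covariable. -/
noncomputable def remainderTransform {d : ℕ} (b r : (Fin (d + 1) → ℝ) → (Fin (d + 1) → ℝ) → ℂ)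
    (x : Fin (d + 1) → ℝ) (η : Fin d → ℝ) (t : ℝ) : ℂ :=
  ∫ τ : ℝ, Complex.exp (Complex.I * (t : ℂ) * (τ : ℂ)) * symbolRemainder b r x η τ

/-- The boundary symbol `A(x, η, t)`. -/
noncomputable def boundarySymbol {d : ℕ} (b r : (Fin (d + 1) → ℝ) → (Fin (d + 1) → ℝ) → ℂ)
    (x : Fin (d + 1) → ℝ) (η : Fin d → ℝ) (t : ℝ) : ℂ :=
  (2 * Real.pi : ℂ)⁻¹ * (b x (Fin.snoc (0 : Fin d → ℝ) 1) * oddKernelTransform t +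
    remainderTransform b r x η t)

section

variable {d : ℕ} {b r : (Fin (d + 1) → ℝ) → (Fin (d + 1) → ℝ) → ℂ} {C : ℝ}

lemma continuous_exp_mul_symbolRemainder {m m' : ℝ} (hb : IsSymbol m b) (hr : IsSymbol m' r) :
    Continuous fun p : ((Fin (d + 1) → ℝ) × (Fin d → ℝ) × ℝ) × ℝ =>
      Complex.exp (Complex.I * (p.1.2.2 : ℂ) * (p.2 : ℂ)) *
        symbolRemainder b r p.1.1 p.1.2.1 p.2 := by
  have h1 : Continuous fun p : ((Fin (d + 1) → ℝ) × (Fin d → ℝ) × ℝ) × ℝ =>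
      (p.1.1, p.1.2.1, p.2) := by fun_prop
  have h2 : Continuous fun p : ((Fin (d + 1) → ℝ) × (Fin d → ℝ) × ℝ) × ℝ =>
      Complex.exp (Complex.I * (p.1.2.2 : ℂ) * (p.2 : ℂ)) := by fun_prop
  exact h2.mul ((continuous_symbolRemainder hb hr).comp h1)

lemma norm_exp_mul_symbolRemainder_le
    (hC : ∀ x η τ, ‖symbolRemainder b r x η τ‖ ≤ C * (1 + ‖η‖) * (1 + τ ^ 2)⁻¹)
    (x : Fin (d + 1) → ℝ) (η : Fin d → ℝ) (t τ : ℝ) :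
    ‖Complex.exp (Complex.I * (t : ℂ) * (τ : ℂ)) * symbolRemainder b r x η τ‖ ≤
      C * (1 + ‖η‖) * (1 + τ ^ 2)⁻¹ := by
  rw [norm_mul, norm_exp_I_mul_ofReal_mul_ofReal, one_mul]
  exact hC x η τ

lemma integrable_exp_mul_symbolRemainder {m m' : ℝ} (hb : IsSymbol m b) (hr : IsSymbol m' r)
    (hC : ∀ x η τ, ‖symbolRemainder b r x η τ‖ ≤ C * (1 + ‖η‖) * (1 + τ ^ 2)⁻¹)
    (x : Fin (d + 1) → ℝ) (η : Fin d → ℝ) (t : ℝ) :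
    Integrable fun τ : ℝ =>
      Complex.exp (Complex.I * (t : ℂ) * (τ : ℂ)) * symbolRemainder b r x η τ :=
  (integrable_inv_one_add_sq.const_mul (C * (1 + ‖η‖))).mono'
    ((continuous_exp_mul_symbolRemainder hb hr).comp
      (Continuous.prodMk_right (x, η, t))).aestronglyMeasurable
    (Eventually.of_forall (norm_exp_mul_symbolRemainder_le hC x η t))

lemma tendsto_boundarySymbol {m m' : ℝ} (hb : IsSymbol m b) (hr : IsSymbol m' r)
    (hC : ∀ x η τ, ‖symbolRemainder b r x η τ‖ ≤ C * (1 + ‖η‖) * (1 + τ ^ 2)⁻¹)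
    (x : Fin (d + 1) → ℝ) (η : Fin d → ℝ) (t : ℝ) :
    Tendsto (fun R : ℝ => (2 * Real.pi : ℂ)⁻¹ *
      ∫ τ in (-R)..R, Complex.exp (Complex.I * (t : ℂ) * (τ : ℂ)) *
        (b x (Fin.snoc η τ) + r x (Fin.snoc η τ))) atTop (𝓝 (boundarySymbol b r x η t)) := by
  have hk : Continuous fun τ : ℝ =>
      Complex.exp (Complex.I * (t : ℂ) * (τ : ℂ)) * ((τ * (1 + τ ^ 2)⁻¹ : ℝ) : ℂ) :=
    (by fun_prop : Continuous fun τ : ℝ => Complex.exp (Complex.I * (t : ℂ) * (τ : ℂ))).mul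
      (Complex.continuous_ofReal.comp (continuous_id.mul continuous_inv_one_add_sq))
  have hrem := integrable_exp_mul_symbolRemainder hb hr hC x η t
  have hsplit : ∀ R : ℝ, ∫ τ in (-R)..R, Complex.exp (Complex.I * (t : ℂ) * (τ : ℂ)) *
        (b x (Fin.snoc η τ) + r x (Fin.snoc η τ)) =
      b x (Fin.snoc (0 : Fin d → ℝ) 1) * (∫ τ in (-R)..R,
        Complex.exp (Complex.I * (t : ℂ) * (τ : ℂ)) * ((τ * (1 + τ ^ 2)⁻¹ : ℝ) : ℂ)) +
      ∫ τ in (-R)..R, Complex.exp (Complex.I * (t : ℂ) * (τ : ℂ)) * symbolRemainder b r x η τ := by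
    intro R
    rw [← intervalIntegral.integral_const_mul, ← intervalIntegral.integral_add
      ((hk.const_mul _).intervalIntegrable _ _) hrem.intervalIntegrable]
    congr 1
    ext τ
    rw [symbolRemainder]
    ring
  simp_rw [hsplit]
  exact (((tendsto_oddKernelTransform t).const_mul _).add
    (intervalIntegral_tendsto_integral hrem tendsto_neg_atTop_atBot tendsto_id)).const_mul _

lemma continuous_remainderTransform {m m' : ℝ} (hb : IsSymbol m b) (hr : IsSymbol m' r)
    (hC : ∀ x η τ, ‖symbolRemainder b r x η τ‖ ≤ C * (1 + ‖η‖) * (1 + τ ^ 2)⁻¹)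
    (η : Fin d → ℝ) :
    Continuous fun p : (Fin (d + 1) → ℝ) × ℝ => remainderTransform b r p.1 η p.2 := by
  refine continuous_of_dominated
    (fun p => (integrable_exp_mul_symbolRemainder hb hr hC p.1 η p.2).aestronglyMeasurable)
    (fun p => Eventually.of_forall (norm_exp_mul_symbolRemainder_le hC p.1 η p.2))
    (integrable_inv_one_add_sq.const_mul (C * (1 + ‖η‖))) (Eventually.of_forall fun τ => ?_)
  exact (continuous_exp_mul_symbolRemainder hb hr).comp
    (by fun_prop : Continuous fun p : (Fin (d + 1) → ℝ) × ℝ => ((p.1, η, p.2), τ))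

lemma stronglyMeasurable_boundarySymbol {m m' : ℝ} (hb : IsSymbol m b) (hr : IsSymbol m' r)
    (x : Fin (d + 1) → ℝ) (t : ℝ) : StronglyMeasurable fun η => boundarySymbol b r x η t := by
  refine StronglyMeasurable.const_mul (stronglyMeasurable_const.add ?_) _
  refine StronglyMeasurable.integral_prod_right (f := fun (η : Fin d → ℝ) (τ : ℝ) =>
    Complex.exp (Complex.I * (t : ℂ) * (τ : ℂ)) * symbolRemainder b r x η τ) ?_
  exact ((continuous_exp_mul_symbolRemainder hb hr).comp (by fun_prop : Continuous
    fun p : (Fin d → ℝ) × ℝ => ((x, p.1, t), p.2))).stronglyMeasurable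

lemma norm_remainderTransform_le
    (hC : ∀ x η τ, ‖symbolRemainder b r x η τ‖ ≤ C * (1 + ‖η‖) * (1 + τ ^ 2)⁻¹)
    (x : Fin (d + 1) → ℝ) (η : Fin d → ℝ) (t : ℝ) :
    ‖remainderTransform b r x η t‖ ≤ C * (1 + ‖η‖) * Real.pi := by
  rw [← integral_univ_inv_one_add_sq, ← integral_const_mul]
  exact norm_integral_le_of_norm_le (integrable_inv_one_add_sq.const_mul _)
    (Eventually.of_forall (norm_exp_mul_symbolRemainder_le hC x η t))

lemma norm_boundarySymbol_le {C₀ K : ℝ} (hC₀ : ∀ x ξ, ‖b x ξ‖ ≤ C₀)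
    (hC : ∀ x η τ, ‖symbolRemainder b r x η τ‖ ≤ C * (1 + ‖η‖) * (1 + τ ^ 2)⁻¹)
    (x : Fin (d + 1) → ℝ) (η : Fin d → ℝ) {t : ℝ} (hK : ‖oddKernelTransform t‖ ≤ K) :
    ‖boundarySymbol b r x η t‖ ≤
      (2 * Real.pi)⁻¹ * (C₀ * K + C * (1 + ‖η‖) * Real.pi) := by
  have h0 : ‖(2 * Real.pi : ℂ)⁻¹‖ = (2 * Real.pi)⁻¹ := by
    simp [abs_of_pos Real.pi_pos]
  rw [boundarySymbol, norm_mul, h0]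
  refine mul_le_mul_of_nonneg_left (norm_add_le_of_le ?_ (norm_remainderTransform_le hC x η t))
    (by positivity)
  rw [norm_mul]
  exact mul_le_mul (hC₀ _ _) hK (norm_nonneg _) ((norm_nonneg _).trans (hC₀ 0 0))

lemma norm_layer_integrand_le {C₀ K : ℝ} (hC₀ : ∀ x ξ, ‖b x ξ‖ ≤ C₀)
    (hC : ∀ x η τ, ‖symbolRemainder b r x η τ‖ ≤ C * (1 + ‖η‖) * (1 + τ ^ 2)⁻¹)
    (F : SchwartzMap (Fin d → ℝ) ℂ) (x' : Fin d → ℝ) (x : Fin (d + 1) → ℝ) (η : Fin d → ℝ)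
    {t : ℝ} (hK : ‖oddKernelTransform t‖ ≤ K) :
    ‖Complex.exp (Complex.I * ((∑ i, x' i * η i : ℝ) : ℂ)) * boundarySymbol b r x η t * F η‖ ≤
      (2 * Real.pi)⁻¹ * (C₀ * K + C * (1 + ‖η‖) * Real.pi) * ‖F η‖ := by
  rw [norm_mul, norm_mul, Complex.norm_exp_I_mul_ofReal, one_mul]
  gcongr
  exact norm_boundarySymbol_le hC₀ hC x η hK

lemma integrable_layer_bound (C₀ K C : ℝ) (F : SchwartzMap (Fin d → ℝ) ℂ) :
    Integrable fun η : Fin d → ℝ =>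
      (2 * Real.pi)⁻¹ * (C₀ * K + C * (1 + ‖η‖) * Real.pi) * ‖F η‖ := by
  have h0 := F.integrable_pow_mul volume 0
  have h1 := F.integrable_pow_mul volume 1
  refine ((h0.const_mul ((2 * Real.pi)⁻¹ * (C₀ * K + C * Real.pi))).add
    (h1.const_mul ((2 * Real.pi)⁻¹ * (C * Real.pi)))).congr (Eventually.of_forall fun η => ?_)
  simp only [Pi.add_apply, pow_zero, pow_one]
  ring

lemma aestronglyMeasurable_layer_integrand {m m' : ℝ} (hb : IsSymbol m b) (hr : IsSymbol m' r)
    (F : SchwartzMap (Fin d → ℝ) ℂ) (x' : Fin d → ℝ) (x : Fin (d + 1) → ℝ) (t : ℝ) :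
    AEStronglyMeasurable fun η : Fin d → ℝ =>
      Complex.exp (Complex.I * ((∑ i, x' i * η i : ℝ) : ℂ)) * boundarySymbol b r x η t * F η := by
  have he : Continuous fun η : Fin d → ℝ =>
      Complex.exp (Complex.I * ((∑ i, x' i * η i : ℝ) : ℂ)) := by fun_prop
  exact ((he.stronglyMeasurable.mul (stronglyMeasurable_boundarySymbol hb hr x t)).mul
    F.continuous.stronglyMeasurable).aestronglyMeasurable

lemma integrable_layer_integrand {m m' : ℝ} (hb : IsSymbol m b) (hr : IsSymbol m' r)
    {C₀ : ℝ} (hC₀ : ∀ x ξ, ‖b x ξ‖ ≤ C₀)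
    (hC : ∀ x η τ, ‖symbolRemainder b r x η τ‖ ≤ C * (1 + ‖η‖) * (1 + τ ^ 2)⁻¹)
    (F : SchwartzMap (Fin d → ℝ) ℂ) (x' : Fin d → ℝ) (x : Fin (d + 1) → ℝ) (t : ℝ) :
    Integrable fun η : Fin d → ℝ =>
      Complex.exp (Complex.I * ((∑ i, x' i * η i : ℝ) : ℂ)) * boundarySymbol b r x η t * F η :=
  (integrable_layer_bound C₀ ‖oddKernelTransform t‖ C F).mono'
    (aestronglyMeasurable_layer_integrand hb hr F x' x t)
    (Eventually.of_forall fun η => norm_layer_integrand_le hC₀ hC F x' x η le_rfl)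

/-- The boundary symbol on the side of the hyperplane where `t` has sign `σ`. -/
lemma tendsto_boundarySymbol_side {m m' : ℝ} (hb : IsSymbol m b) (hr : IsSymbol m' r)
    (hC : ∀ x η τ, ‖symbolRemainder b r x η τ‖ ≤ C * (1 + ‖η‖) * (1 + τ ^ 2)⁻¹)
    {l : Filter ℝ} (hl : l ≤ 𝓝 0) {σ : ℝ} (hσ : ∀ᶠ t in l, Real.sign t = σ)
    (x' : Fin d → ℝ) (η : Fin d → ℝ) :
    Tendsto (fun t : ℝ => boundarySymbol b r (Fin.snoc x' t) η t) l
      (𝓝 (Complex.I / 2 * σ * b (Fin.snoc x' 0) (Fin.snoc (0 : Fin d → ℝ) 1) +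
        boundarySymbol b r (Fin.snoc x' 0) η 0)) := by
  have hpath : Continuous fun t : ℝ => (Fin.snoc x' t : Fin (d + 1) → ℝ) :=
    continuous_snoc.comp (Continuous.prodMk_right x')
  have hbc : Tendsto (fun t : ℝ => b (Fin.snoc x' t) (Fin.snoc (0 : Fin d → ℝ) 1)) l
      (𝓝 (b (Fin.snoc x' 0) (Fin.snoc (0 : Fin d → ℝ) 1))) :=
    ((hb.1.continuous.comp (hpath.prodMk continuous_const)).tendsto 0).mono_left hl
  have hrc : Tendsto (fun t : ℝ => remainderTransform b r (Fin.snoc x' t) η t) l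
      (𝓝 (remainderTransform b r (Fin.snoc x' 0) η 0)) :=
    (((continuous_remainderTransform hb hr hC η).comp
      (hpath.prodMk continuous_id)).tendsto 0).mono_left hl
  have h := ((hbc.mul (tendsto_oddKernelTransform_side hl hσ)).add hrc).const_mul
    (2 * Real.pi : ℂ)⁻¹
  refine (h.congr fun t => rfl).trans (le_of_eq (congrArg 𝓝 ?_))
  rw [boundarySymbol, oddKernelTransform_zero]
  have hpi : (Real.pi : ℂ) ≠ 0 := by exact_mod_cast Real.pi_ne_zero
  push_cast
  field_simp
  ring

/-- The one-sided limit of the layer potential, on the side where `t` has sign `σ`. -/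
lemma tendsto_layer_side {m m' : ℝ} (hb : IsSymbol m b) (hr : IsSymbol m' r)
    {C₀ : ℝ} (hC₀ : ∀ x ξ, ‖b x ξ‖ ≤ C₀)
    (hC : ∀ x η τ, ‖symbolRemainder b r x η τ‖ ≤ C * (1 + ‖η‖) * (1 + τ ^ 2)⁻¹)
    (h : SchwartzMap (Fin d → ℝ) ℂ) {l : Filter ℝ} [l.IsCountablyGenerated] (hl : l ≤ 𝓝 0)
    {σ : ℝ} (hσ : ∀ᶠ t in l, Real.sign t = σ) (x' : Fin d → ℝ) :
    Tendsto (fun t : ℝ => (((2 * Real.pi) ^ d : ℝ) : ℂ)⁻¹ * ∫ η : Fin d → ℝ,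
        Complex.exp (Complex.I * ((∑ i, x' i * η i : ℝ) : ℂ)) *
          boundarySymbol b r (Fin.snoc x' t) η t * fTrans d (fun y => h y) η) l
      (𝓝 (Complex.I / 2 * σ * b (Fin.snoc x' 0) (Fin.snoc (0 : Fin d → ℝ) 1) * h x' +
        (((2 * Real.pi) ^ d : ℝ) : ℂ)⁻¹ * ∫ η : Fin d → ℝ,
          Complex.exp (Complex.I * ((∑ i, x' i * η i : ℝ) : ℂ)) *
            boundarySymbol b r (Fin.snoc x' 0) η 0 * fTrans d (fun y => h y) η)) := by
  obtain ⟨F, hF⟩ := exists_schwartzMap_eq_fTrans h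
  have hinv := integral_exp_mul_fTrans h x'
  simp_rw [← hF] at hinv ⊢
  set c := Complex.I / 2 * σ * b (Fin.snoc x' 0) (Fin.snoc (0 : Fin d → ℝ) 1)
  have hK : ∀ᶠ t in l, ‖oddKernelTransform t‖ ≤ ‖Complex.I * (Real.pi * σ : ℝ)‖ + 1 :=
    ((tendsto_oddKernelTransform_side hl hσ).norm.eventually_lt_const (lt_add_one _)).mono
      fun t ht => ht.le
  have hlim := tendsto_integral_filter_of_dominated_convergence _
    (Eventually.of_forall fun t : ℝ =>
      aestronglyMeasurable_layer_integrand hb hr F x' (Fin.snoc x' t) t)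
    (hK.mono fun t ht => Eventually.of_forall fun η =>
      norm_layer_integrand_le hC₀ hC F x' (Fin.snoc x' t) η ht)
    (integrable_layer_bound C₀ _ C F)
    (Eventually.of_forall fun η => ((tendsto_boundarySymbol_side hb hr hC hl hσ x' η).const_mul
      (Complex.exp (Complex.I * ((∑ i, x' i * η i : ℝ) : ℂ)))).mul_const (F η))
  refine (hlim.const_mul _).trans (le_of_eq (congrArg 𝓝 ?_))
  have hexpF : Integrable fun η : Fin d → ℝ =>
      Complex.exp (Complex.I * ((∑ i, x' i * η i : ℝ) : ℂ)) * F η := by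
    refine F.integrable.norm.mono' (Continuous.aestronglyMeasurable ?_)
      (Eventually.of_forall fun η => ?_)
    · exact (by fun_prop : Continuous fun η : Fin d → ℝ =>
        Complex.exp (Complex.I * ((∑ i, x' i * η i : ℝ) : ℂ))).mul F.continuous
    · rw [norm_mul, Complex.norm_exp_I_mul_ofReal, one_mul]
  rw [← hinv, mul_left_comm, ← mul_add, ← integral_const_mul c, ← integral_add
    (hexpF.const_mul c) (integrable_layer_integrand hb hr hC₀ hC F x' (Fin.snoc x' 0) 0)]
  congr 1
  refine integral_congr_ae (Eventually.of_forall fun η => ?_)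
  simp only [c]
  ring

end

/-- Jump relations for the layer potential of a classical symbol `a = b + r` of order `−1`
with odd principal symbol on `ℝⁿ`, `n = d+1 ≥ 2`.  The boundary symbols
`A(x,η,t) = lim_{R→∞} (2π)⁻¹ ∫_{−R}^{R} e^{itτ} a(x,(η,τ)) dτ` exist; the restrictions to
the hyperplanes `{x_n = t}` of the layer potential `a(x,D)(h ⊗ δ_Γ)` applied to a Schwartz
density `h`, namely `u(x',t) = (2π)^{−(n−1)} ∫ e^{ix'·η} A((x',t),η,t) ĥ(η) dη`, are given
by absolutely convergent integrals, and they satisfy the one-sided limit relations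
`u(x',t) → ±(i/2)·b((x',0),e_n)·h(x') + u₀(x')` as `t → 0±`, where
`u₀(x') = (2π)^{−(n−1)} ∫ e^{ix'·η} A((x',0),η,0) ĥ(η) dη`; in particular the jump across
`{x_n = 0}` equals `i·b((x',0),e_n)·h(x')`. -/
theorem layer_potential_jump_order_neg_one (d : ℕ) (hd : 1 ≤ d)
    (b r : (Fin (d + 1) → ℝ) → (Fin (d + 1) → ℝ) → ℂ)
    (hb : IsSymbol (-1) b) (hr : IsSymbol (-2) r)
    (hb_hom : ∀ (x ξ : Fin (d + 1) → ℝ) (lam : ℝ), 0 < lam →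
      1 ≤ euclNorm ξ → 1 ≤ lam * euclNorm ξ → b x (lam • ξ) = (lam : ℂ)⁻¹ * b x ξ)
    (hb_odd : ∀ (x ξ : Fin (d + 1) → ℝ), 1 ≤ euclNorm ξ → b x (-ξ) = -b x ξ)
    (h : SchwartzMap (Fin d → ℝ) ℂ) :
    ∃ A : (Fin (d + 1) → ℝ) → (Fin d → ℝ) → ℝ → ℂ,
      (∀ (x : Fin (d + 1) → ℝ) (η : Fin d → ℝ) (t : ℝ),
        Tendsto (fun R : ℝ => (2 * Real.pi : ℂ)⁻¹ *
            ∫ τ in (-R)..R, Complex.exp (Complex.I * (t : ℂ) * (τ : ℂ)) *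
              (b x (Fin.snoc η τ) + r x (Fin.snoc η τ)))
          atTop (𝓝 (A x η t))) ∧
      (∀ (x' : Fin d → ℝ) (t : ℝ),
        Integrable fun η : Fin d → ℝ =>
          Complex.exp (Complex.I * ((∑ i, x' i * η i : ℝ) : ℂ)) *
            A (Fin.snoc x' t) η t * fTrans d (fun y => h y) η) ∧
      (∀ x' : Fin d → ℝ,
        Tendsto (fun t : ℝ => (((2 * Real.pi) ^ d : ℝ) : ℂ)⁻¹ *
            ∫ η : Fin d → ℝ,
              Complex.exp (Complex.I * ((∑ i, x' i * η i : ℝ) : ℂ)) *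
                A (Fin.snoc x' t) η t * fTrans d (fun y => h y) η)
          (𝓝[>] 0)
          (𝓝 ((Complex.I / 2) * b (Fin.snoc x' 0) (Fin.snoc (0 : Fin d → ℝ) 1) * h x' +
            (((2 * Real.pi) ^ d : ℝ) : ℂ)⁻¹ *
              ∫ η : Fin d → ℝ,
                Complex.exp (Complex.I * ((∑ i, x' i * η i : ℝ) : ℂ)) *
                  A (Fin.snoc x' 0) η 0 * fTrans d (fun y => h y) η)) ∧
        Tendsto (fun t : ℝ => (((2 * Real.pi) ^ d : ℝ) : ℂ)⁻¹ *
            ∫ η : Fin d → ℝ,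
              Complex.exp (Complex.I * ((∑ i, x' i * η i : ℝ) : ℂ)) *
                A (Fin.snoc x' t) η t * fTrans d (fun y => h y) η)
          (𝓝[<] 0)
          (𝓝 (-(Complex.I / 2) * b (Fin.snoc x' 0) (Fin.snoc (0 : Fin d → ℝ) 1) * h x' +
            (((2 * Real.pi) ^ d : ℝ) : ℂ)⁻¹ *
              ∫ η : Fin d → ℝ,
                Complex.exp (Complex.I * ((∑ i, x' i * η i : ℝ) : ℂ)) *
                  A (Fin.snoc x' 0) η 0 * fTrans d (fun y => h y) η))) := by
  obtain ⟨C, -, hC⟩ := exists_norm_symbolRemainder_le hb hr hb_hom hb_odd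
  obtain ⟨C₀, -, hC₀⟩ := hb.exists_norm_le (by norm_num)
  refine ⟨boundarySymbol b r, tendsto_boundarySymbol hb hr hC, fun x' t => ?_, fun x' => ⟨?_, ?_⟩⟩
  · obtain ⟨F, hF⟩ := exists_schwartzMap_eq_fTrans h
    simp_rw [← hF]
    exact integrable_layer_integrand hb hr hC₀ hC F x' _ t
  · have hlim := tendsto_layer_side hb hr hC₀ hC h (l := 𝓝[>] 0) nhdsWithin_le_nhds
      (σ := 1) (eventually_mem_nhdsWithin.mono fun t ht => Real.sign_of_pos ht) x'
    simpa only [Complex.ofReal_one, mul_one] using hlim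
  · have hlim := tendsto_layer_side hb hr hC₀ hC h (l := 𝓝[<] 0) nhdsWithin_le_nhds
      (σ := -1) (eventually_mem_nhdsWithin.mono fun t ht => Real.sign_of_neg ht) x'
    simpa only [Complex.ofReal_neg, Complex.ofReal_one, mul_neg, mul_one] using hlim
end
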